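/- The function F(n_0,n_1,…,n_r) = lim_{m→∞} dim_𝕜( 𝐉_{m𝐧} / I_{m n_0} 𝐉_{m𝐧} ) / m^d is well defined (the limit exists) for all n_0 ∈ ℕ and 𝐧 = (n_1,…,n_r) ∈ ℕ^r, and it is equal to a homogeneous polynomial G(n_0,n_1,…,n_r) of total degree d with non-negative real coefficients. Moreover, G has no term of the form α·n_1^{d_1}⋯n_r^{d_r} with α ≠ 0 and d_1+⋯+d_r = d; that is, every monomial of G with nonzero coefficient has positive exponent in n_0. -/

import Mathlib

open Filter MvPolynomial Pointwise MeasureTheory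

noncomputable section

/-- The graded irrelevant (maximal graded) ideal `𝔪 = (x_1, …, x_d)` of `𝕜[x_1, …, x_d]`. -/
def mId (𝕜 : Type*) [Field 𝕜] (d : ℕ) : Ideal (MvPolynomial (Fin d) 𝕜) :=
  Ideal.span (Set.range MvPolynomial.X)

/-- A graded family of ideals: `I 0 = R` and `I i * I j ⊆ I (i + j)`. -/
def IsGradedFamily {R : Type*} [CommSemiring R] (I : ℕ → Ideal R) : Prop :=
  I 0 = ⊤ ∧ ∀ i j : ℕ, I i * I j ≤ I (i + j)

/-- An `𝔪`-primary ideal of the polynomial ring: a proper ideal containing a power of `𝔪`. -/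
def IsMPrimary {𝕜 : Type*} [Field 𝕜] {d : ℕ} (I : Ideal (MvPolynomial (Fin d) 𝕜)) : Prop :=
  I ≠ ⊤ ∧ ∃ k : ℕ, mId 𝕜 d ^ k ≤ I

/-- A monomial ideal: an ideal generated by monomials. -/
def IsMonomialIdeal {𝕜 : Type*} [Field 𝕜] {d : ℕ} (I : Ideal (MvPolynomial (Fin d) 𝕜)) : Prop :=
  ∃ S : Set (Fin d →₀ ℕ), I = Ideal.span ((fun m => MvPolynomial.monomial m (1 : 𝕜)) '' S)

/-- A nonzero monomial ideal generated by monomials of degree at most `b`;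
for nonzero monomial ideals this is exactly the condition `β(I) ≤ b`. -/
def IsMonomialBounded {𝕜 : Type*} [Field 𝕜] {d : ℕ} (I : Ideal (MvPolynomial (Fin d) 𝕜))
    (b : ℕ) : Prop :=
  I ≠ ⊥ ∧ ∃ S : Set (Fin d →₀ ℕ), (∀ m ∈ S, (∑ j, m j) ≤ b) ∧
    I = Ideal.span ((fun m => MvPolynomial.monomial m (1 : 𝕜)) '' S)

/-- The `𝕜`-vector space dimension of the quotient `A / (A ⊓ B)`; for `B ⊆ A`
this is `dim_𝕜 (A / B)`. -/
def quotDim (𝕜 : Type*) [Field 𝕜] {R : Type*} [CommRing R] [Algebra 𝕜 R]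
    (A B : Ideal R) : ℕ :=
  Module.finrank 𝕜
    (↥(Submodule.restrictScalars 𝕜 A) ⧸
      Submodule.comap (Submodule.restrictScalars 𝕜 A).subtype (Submodule.restrictScalars 𝕜 B))

/-- The number of `w ∈ ℕ^s` with `v + |w| = x`. -/
def simplexCount (v : ℕ) : ℕ → ℕ → ℕ
  | 0, x => if x = v then 1 else 0
  | s + 1, x => if v ≤ x then (x - v + s).choose s else 0

theorem simplexCount_succ_succ (v s x : ℕ) :
    simplexCount (v + 1) s (x + 1) = simplexCount v s x := by
  cases s <;> simp [simplexCount]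

theorem simplexCount_succ_zero (v s : ℕ) : simplexCount (v + 1) s 0 = 0 := by
  cases s <;> simp [simplexCount]

theorem simplexCount_step (v s x : ℕ) :
    simplexCount v (s + 1) (x + 1) = simplexCount v (s + 1) x + simplexCount v s (x + 1) := by
  cases s with
  | zero =>
    simp only [simplexCount]
    split_ifs <;> (try simp) <;> omega
  | succ s =>
    simp only [simplexCount]
    rcases lt_trichotomy v (x + 1) with h | h | h
    · have h1 : v ≤ x := by omega
      have h2 : v ≤ x + 1 := by omega
      rw [if_pos h1, if_pos h2, if_pos h2]
      obtain ⟨y, rfl⟩ := Nat.exists_eq_add_of_le h1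
      have e1 : v + y + 1 - v + (s + 1) = (y + s + 1) + 1 := by omega
      have e2 : v + y - v + (s + 1) = y + s + 1 := by omega
      have e3 : v + y + 1 - v + s = y + s + 1 := by omega
      rw [e1, e2, e3, Nat.choose_succ_succ, add_comm]
    · subst h
      simp
    · rw [if_neg (by omega), if_neg (by omega), if_neg (by omega)]

theorem sum_simplexCount (v s x : ℕ) :
    ∑ j ∈ Finset.range (x + 1), simplexCount v s (x - j) = simplexCount v (s + 1) x := by
  have h := Finset.sum_range_reflect (fun j => simplexCount v s j) (x + 1)
  simp only [Nat.add_sub_cancel] at h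
  rw [h]
  clear h
  induction x with
  | zero =>
    cases s <;> simp [simplexCount]
  | succ x ih => rw [Finset.sum_range_succ, ih, simplexCount_step]

section StanleyCone

variable {κ : Type*} [Fintype κ]

/-- The Hilbert function of a Stanley set with offsets `v` and `s k` free directions in block
`k`. -/
def stanleyCount (v s n : κ → ℕ) : ℕ := ∏ k, simplexCount (v k) (s k) (n k)

variable (κ) in
/-- Finite sums of Hilbert functions of Stanley sets. -/
def stanleyCone : AddSubmonoid ((κ → ℕ) → ℕ) :=
  AddSubmonoid.closure (Set.range fun p : (κ → ℕ) × (κ → ℕ) => stanleyCount p.1 p.2)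

theorem stanleyCount_mem (v s : κ → ℕ) : stanleyCount v s ∈ stanleyCone κ :=
  AddSubmonoid.subset_closure ⟨(v, s), rfl⟩

theorem stanleyCone_map {φ : ((κ → ℕ) → ℕ) →+ ((κ → ℕ) → ℕ)}
    (hφ : ∀ v s, φ (stanleyCount v s) ∈ stanleyCone κ) {f : (κ → ℕ) → ℕ}
    (hf : f ∈ stanleyCone κ) : φ f ∈ stanleyCone κ := by
  have : stanleyCone κ ≤ (stanleyCone κ).comap φ := by
    refine (AddSubmonoid.closure_le).2 ?_
    rintro _ ⟨p, rfl⟩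
    exact hφ _ _
  exact this hf

variable [DecidableEq κ]

/-- Translation of a function by a unit vector. -/
def shiftHom (k : κ) : ((κ → ℕ) → ℕ) →+ ((κ → ℕ) → ℕ) where
  toFun f n := if n k = 0 then 0 else f (Function.update n k (n k - 1))
  map_zero' := by ext n; simp
  map_add' f g := by ext n; simp only [Pi.add_apply]; split_ifs <;> simp

/-- Partial sums of a function in one variable. -/
def cumHom (k : κ) : ((κ → ℕ) → ℕ) →+ ((κ → ℕ) → ℕ) where
  toFun f n := ∑ j ∈ Finset.range (n k + 1), f (Function.update n k (n k - j))
  map_zero' := by ext n; simp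
  map_add' f g := by ext n; simp [Finset.sum_add_distrib]

theorem stanleyCount_update (v s n : κ → ℕ) (k : κ) (x : ℕ) :
    stanleyCount v s (Function.update n k x) =
      simplexCount (v k) (s k) x *
        ∏ i ∈ Finset.univ.erase k, simplexCount (v i) (s i) (n i) := by
  rw [stanleyCount, ← Finset.mul_prod_erase _ _ (Finset.mem_univ k)]
  congr 1
  · simp
  · refine Finset.prod_congr rfl fun i hi => ?_
    rw [Function.update_of_ne (Finset.ne_of_mem_erase hi)]

theorem stanleyCount_eq (v s n : κ → ℕ) (k : κ) :
    stanleyCount v s n =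
      simplexCount (v k) (s k) (n k) *
        ∏ i ∈ Finset.univ.erase k, simplexCount (v i) (s i) (n i) := by
  rw [← stanleyCount_update, Function.update_eq_self]

theorem shiftHom_mem (k : κ) {f : (κ → ℕ) → ℕ} (hf : f ∈ stanleyCone κ) :
    shiftHom k f ∈ stanleyCone κ := by
  refine stanleyCone_map (fun v s => ?_) hf
  convert stanleyCount_mem (Function.update v k (v k + 1)) s
  ext n
  have e : ∏ i ∈ Finset.univ.erase k,
      simplexCount (Function.update v k (v k + 1) i) (s i) (n i) =
      ∏ i ∈ Finset.univ.erase k, simplexCount (v i) (s i) (n i) :=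
    Finset.prod_congr rfl fun i hi => by
      rw [Function.update_of_ne (Finset.ne_of_mem_erase hi)]
  rw [stanleyCount_eq _ _ n k, e]
  simp only [shiftHom, AddMonoidHom.coe_mk, ZeroHom.coe_mk, Function.update_self]
  split_ifs with h
  · rw [h, simplexCount_succ_zero, zero_mul]
  · rw [stanleyCount_update]
    obtain ⟨x, hx⟩ := Nat.exists_eq_succ_of_ne_zero h
    rw [hx, Nat.succ_eq_add_one, simplexCount_succ_succ, Nat.add_sub_cancel]

theorem cumHom_mem (k : κ) {f : (κ → ℕ) → ℕ} (hf : f ∈ stanleyCone κ) :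
    cumHom k f ∈ stanleyCone κ := by
  refine stanleyCone_map (fun v s => ?_) hf
  convert stanleyCount_mem v (Function.update s k (s k + 1))
  ext n
  have e : ∏ i ∈ Finset.univ.erase k,
      simplexCount (v i) (Function.update s k (s k + 1) i) (n i) =
      ∏ i ∈ Finset.univ.erase k, simplexCount (v i) (s i) (n i) :=
    Finset.prod_congr rfl fun i hi => by
      rw [Function.update_of_ne (Finset.ne_of_mem_erase hi)]
  rw [stanleyCount_eq _ _ n k, e]
  simp only [cumHom, AddMonoidHom.coe_mk, ZeroHom.coe_mk, Function.update_self,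
    stanleyCount_update]
  rw [← Finset.sum_mul, sum_simplexCount]

/-- A convolution in one variable of an eventually constant sequence of functions. -/
theorem sum_shift_mem (k : κ) (J : ℕ) (f : ℕ → (κ → ℕ) → ℕ) (hf : ∀ j, f j ∈ stanleyCone κ)
    (hJ : ∀ j, J ≤ j → f j = f J) :
    (fun n => ∑ j ∈ Finset.range (n k + 1), f j (Function.update n k (n k - j))) ∈
      stanleyCone κ := by
  induction J generalizing f with
  | zero =>
    convert cumHom_mem k (hf 0) using 1
    ext n
    refine Finset.sum_congr rfl fun j _ => ?_
    rw [hJ j (Nat.zero_le _)]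
  | succ J ih =>
    have h := add_mem (hf 0) (shiftHom_mem k (ih (fun j => f (j + 1)) (fun j => hf _)
      (fun j hj => hJ (j + 1) (by omega))))
    convert h using 1
    ext n
    rw [Finset.sum_range_succ', add_comm]
    simp only [Nat.sub_zero, Function.update_eq_self, Pi.add_apply, shiftHom,
      AddMonoidHom.coe_mk, ZeroHom.coe_mk, Function.update_self, Function.update_idem]
    congr 1
    split_ifs with h
    · simp [h]
    · have e : n k - 1 + 1 = n k := by omega
      rw [e]
      refine Finset.sum_congr rfl fun j _ => ?_
      rw [Nat.sub_sub, add_comm 1 j]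

end StanleyCone

section BlockDegree

variable {κ : Type*} [DecidableEq κ]

/-- The block degree of an exponent vector; coordinates of weight `none` are ignored. -/
def blockDegree {M : ℕ} (wt : Fin M → Option κ) (u : Fin M → ℕ) : κ → ℕ :=
  fun k => ∑ i, if wt i = some k then u i else 0

theorem exists_stable_of_antitone {M : ℕ} (E : ℕ → Set (Fin M → ℕ)) (hE : Antitone E)
    (hl : ∀ j, IsLowerSet (E j)) : ∃ J, ∀ j, J ≤ j → E j = E J := by
  by_contra! hcon
  have h1 : ∀ J, ∃ j u, J < j ∧ u ∈ E J ∧ u ∉ E j := by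
    intro J
    obtain ⟨j, hj, hne⟩ := hcon J
    have hss : E j ⊂ E J := (hE hj).ssubset_of_ne hne
    obtain ⟨u, hu, hu'⟩ := Set.exists_of_ssubset hss
    refine ⟨j, u, lt_of_le_of_ne hj ?_, hu, hu'⟩
    rintro rfl
    exact hne rfl
  choose nx u hlt hmem hnot using h1
  set s : ℕ → ℕ := fun n => nx^[n] 0 with hs
  have hsucc : ∀ n, s (n + 1) = nx (s n) := fun n => Function.iterate_succ_apply' nx n 0
  have hmono : StrictMono s := strictMono_nat_of_lt_succ fun n => by
    rw [hsucc]; exact hlt _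
  obtain ⟨a, b, hab, hle⟩ := wellQuasiOrdered_le (fun n => u (s n))
  refine hnot (s a) ?_
  rw [← hsucc]
  exact hl _ hle (hE (hmono.monotone hab) (hmem (s b)))

theorem finite_blockDegree_fiber {M : ℕ} (wt : Fin M → Option κ) (D : Set (Fin M → ℕ))
    (hb : ∀ i, wt i = none → ∃ L, ∀ u ∈ D, u i < L) (n : κ → ℕ) :
    {u ∈ D | blockDegree wt u = n}.Finite := by
  have h : ∀ i, ∃ L, ∀ u ∈ {u ∈ D | blockDegree wt u = n}, u i ≤ L := by
    intro i
    cases hi : wt i with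
    | none =>
      obtain ⟨L, hL⟩ := hb i hi
      exact ⟨L, fun u hu => (hL u hu.1).le⟩
    | some k =>
      refine ⟨n k, fun u hu => ?_⟩
      rw [← hu.2]
      have := Finset.single_le_sum (f := fun i => if wt i = some k then u i else 0)
        (fun _ _ => Nat.zero_le _) (Finset.mem_univ i)
      simpa [blockDegree, hi] using this
  choose L hL using h
  exact (Set.finite_Iic L).subset fun u hu i => hL i u hu

theorem ncard_fiber_eq_sum {M : ℕ} (S : Set (Fin (M + 1) → ℕ)) (hS : S.Finite) (N : ℕ)
    (hN : ∀ u ∈ S, u 0 < N) :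
    S.ncard = ∑ j ∈ Finset.range N, {u : Fin M → ℕ | (Fin.cons j u : Fin (M + 1) → ℕ) ∈ S}.ncard := by
  classical
  rw [Set.ncard_eq_toFinset_card S hS,
    Finset.card_eq_sum_card_fiberwise (f := fun u => u 0) (t := Finset.range N)
      (fun u hu => by simpa using hN u (by simpa using hu))]
  refine Finset.sum_congr rfl fun j _ => ?_
  rw [← Set.ncard_coe_finset, ← Set.ncard_image_of_injective _
    (Fin.cons_right_injective (α := fun _ : Fin (M + 1) => ℕ) j)]
  congr 1
  ext u
  simp only [Finset.coe_filter, Set.Finite.mem_toFinset, Set.mem_ofPred_eq, Set.mem_image]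
  constructor
  · rintro ⟨hu, rfl⟩
    exact ⟨Fin.tail u, by rwa [Fin.cons_self_tail], Fin.cons_self_tail u⟩
  · rintro ⟨v, hv, rfl⟩
    exact ⟨hv, rfl⟩

theorem blockDegree_cons {M : ℕ} (wt : Fin (M + 1) → Option κ) (j : ℕ) (u : Fin M → ℕ) (k : κ) :
    blockDegree wt (Fin.cons j u) k =
      (if wt 0 = some k then j else 0) + blockDegree (fun i => wt i.succ) u k := by
  simp [blockDegree, Fin.sum_univ_succ]

variable [Fintype κ]

/-- The Hilbert function of a lower set of `ℕ^M` is a finite sum of Hilbert functions of Stanley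
sets. -/
theorem ncard_fiber_mem_stanleyCone {M : ℕ} (wt : Fin M → Option κ) (D : Set (Fin M → ℕ))
    (hD : IsLowerSet D) (hb : ∀ i, wt i = none → ∃ L, ∀ u ∈ D, u i < L) :
    (fun n => {u ∈ D | blockDegree wt u = n}.ncard) ∈ stanleyCone κ := by
  induction M with
  | zero =>
    by_cases h : (0 : Fin 0 → ℕ) ∈ D
    · convert stanleyCount_mem (0 : κ → ℕ) 0 using 1
      ext n
      by_cases hn : n = 0
      · subst hn
        have : {u ∈ D | blockDegree wt u = 0} = {0} := by
          ext u
          have hu : u = 0 := Subsingleton.elim _ _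
          subst hu
          have h0 : blockDegree wt 0 = 0 := by ext k; simp [blockDegree]
          exact ⟨fun _ => rfl, fun _ => ⟨h, h0⟩⟩
        rw [this]
        simp [stanleyCount, simplexCount]
      · have : {u ∈ D | blockDegree wt u = n} = ∅ := by
          ext u
          have h0 : blockDegree wt u = 0 := by ext k; simp [blockDegree]
          simp only [Set.mem_ofPred_eq, Set.mem_empty_iff_false, iff_false, not_and, h0]
          exact fun _ e => hn e.symm
        rw [this]
        obtain ⟨k, hk⟩ := Function.ne_iff.1 hn
        rw [stanleyCount, Finset.prod_eq_zero (Finset.mem_univ k)] <;> simp [simplexCount] at *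
        exact hk
    · convert zero_mem (stanleyCone κ) using 1
      ext n
      have : {u ∈ D | blockDegree wt u = n} = ∅ := by
        ext u
        have hu : u = 0 := Subsingleton.elim _ _
        subst hu
        exact ⟨fun hu => h hu.1, fun hu => hu.elim⟩
      rw [this]
      simp
  | succ M ih =>
    set E : ℕ → Set (Fin M → ℕ) := fun j => {u | (Fin.cons j u : Fin (M + 1) → ℕ) ∈ D} with hEdef
    have hElow : ∀ j, IsLowerSet (E j) := fun j u v hvu hu =>
      hD (Fin.cons_le_cons.2 ⟨le_rfl, hvu⟩) hu
    have hEanti : Antitone E := fun i j hij u hu => hD (Fin.cons_le_cons.2 ⟨hij, le_rfl⟩) hu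
    have hEb : ∀ j i, wt (Fin.succ i) = none → ∃ L, ∀ u ∈ E j, u i < L := by
      intro j i hi
      obtain ⟨L, hL⟩ := hb _ hi
      exact ⟨L, fun u hu => by simpa using hL _ hu⟩
    have hmem := fun j => ih (fun i => wt i.succ) (E j) (hElow j) (hEb j)
    cases h0 : wt 0 with
    | none =>
      obtain ⟨L, hL⟩ := hb 0 h0
      convert sum_mem (t := Finset.range L) fun j _ => hmem j using 1
      ext n
      rw [ncard_fiber_eq_sum _ (finite_blockDegree_fiber wt D hb n) L fun u hu => hL u hu.1,
        Finset.sum_apply]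
      refine Finset.sum_congr rfl fun j _ => ?_
      congr 1
      ext u
      simp only [Set.mem_ofPred_eq, E, _root_.funext_iff, blockDegree_cons, h0]
      simp
    | some k =>
      obtain ⟨J, hJ⟩ := exists_stable_of_antitone E hEanti hElow
      convert sum_shift_mem k J (fun j n => {u ∈ E j | blockDegree (fun i => wt i.succ) u = n}.ncard)
        hmem (fun j hj => by simp only [hJ j hj]) using 1
      ext n
      have hlt : ∀ u ∈ {u ∈ D | blockDegree wt u = n}, u 0 < n k + 1 := by
        rintro u ⟨_, rfl⟩
        rw [← Fin.cons_self_tail u, blockDegree_cons]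
        simp only [h0, if_true, Fin.cons_zero]
        omega
      rw [ncard_fiber_eq_sum _ (finite_blockDegree_fiber wt D hb n) _ hlt]
      refine Finset.sum_congr rfl fun j hj => ?_
      have hj' : j ≤ n k := by simpa [Nat.lt_succ_iff] using hj
      congr 1
      ext u
      simp only [Set.mem_ofPred_eq, E, _root_.funext_iff, blockDegree_cons, h0]
      refine and_congr_right fun _ => forall_congr' fun i => ?_
      by_cases hi : i = k
      · subst hi
        simp only [if_true, Function.update_self]
        omega
      · rw [Function.update_of_ne hi, if_neg (fun e => hi (Option.some.inj e).symm), zero_add]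

end BlockDegree

/-- Lexicographically minimal preimages form a lower set of representatives for the image of an
additive map outside an ideal of its target. -/
theorem exists_lowerSet_section {M : ℕ} {X : Type*} [AddCommMonoid X] (φ : (Fin M → ℕ) →+ X)
    (Bad : Set X) (hBad : ∀ u, ∀ x ∈ Bad, φ u + x ∈ Bad) :
    ∃ D : Set (Fin M → ℕ), IsLowerSet D ∧ Set.InjOn φ D ∧ φ '' D = Set.range φ \ Bad := by
  refine ⟨{u | φ u ∉ Bad ∧ ∀ w, φ w = φ u → toLex u ≤ toLex w}, ?_, ?_, ?_⟩
  · rintro w u huw ⟨hw, hmin⟩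
    obtain ⟨z, rfl⟩ := exists_add_of_le huw
    refine ⟨fun hu => hw ?_, fun v hv => ?_⟩
    · rw [add_comm, map_add]
      exact hBad _ _ hu
    · have h := hmin (v + z) (by rw [map_add, map_add, hv])
      rw [toLex_add, toLex_add] at h
      exact le_of_add_le_add_right h
  · rintro u ⟨_, hu⟩ w ⟨_, hw⟩ h
    exact toLex.injective (le_antisymm (hu w h.symm) (hw u h))
  · ext x
    constructor
    · rintro ⟨u, hu, rfl⟩
      exact ⟨⟨u, rfl⟩, hu.1⟩
    · rintro ⟨⟨u, rfl⟩, hx⟩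
      obtain ⟨m, hm, hmin⟩ := WellFounded.has_min (α := Lex (Fin M → ℕ)) wellFounded_lt
        {w | φ (ofLex w) = φ u} ⟨toLex u, rfl⟩
      have hm' : φ (ofLex m) = φ u := hm
      refine ⟨ofLex m, ⟨by rwa [hm'], fun w hw => ?_⟩, hm'⟩
      exact not_lt.1 (hmin (toLex w) (hw.trans hm'))

section PowerSet

variable {κ ι : Type*} [DecidableEq κ] [Fintype ι] {d : ℕ}

/-- The block degree of an exponent vector on generators labelled by blocks. -/
def labelDegree (b : ι → κ) (u : ι → ℕ) : κ → ℕ := fun k => ∑ i, if b i = k then u i else 0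

/-- The exponents in the product of ideals in which block `k`, the ideal generated by the
monomials with exponents `g i`, `b i = k`, occurs to the power `n k`. -/
def powerSet (g : ι → Fin d → ℕ) (b : ι → κ) (n : κ → ℕ) : Set (Fin d → ℕ) :=
  {c | ∃ u : ι → ℕ, labelDegree b u = n ∧ ∑ i, u i • g i ≤ c}

theorem labelDegree_add (b : ι → κ) (u v : ι → ℕ) :
    labelDegree b (u + v) = labelDegree b u + labelDegree b v := by
  ext k
  simp only [labelDegree, Pi.add_apply, ← Finset.sum_add_distrib]
  exact Finset.sum_congr rfl fun i _ => by split_ifs <;> simp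

theorem labelDegree_single [DecidableEq ι] (b : ι → κ) (i : ι) (m : ℕ) :
    labelDegree b (Pi.single i m) = Pi.single (b i) m := by
  ext k
  rw [labelDegree, Finset.sum_eq_single i]
  · simp [Pi.single_apply, eq_comm]
  · intro j _ hj
    simp [hj]
  · simp

theorem sum_single_smul [DecidableEq ι] (g : ι → Fin d → ℕ) (i : ι) (m : ℕ) :
    ∑ l, (Pi.single i m : ι → ℕ) l • g l = m • g i := by
  rw [Finset.sum_eq_single i]
  · simp
  · intro j _ hj
    simp [hj]
  · simp

theorem powerSet_isUpperSet (g : ι → Fin d → ℕ) (b : ι → κ) (n : κ → ℕ) :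
    IsUpperSet (powerSet g b n) := by
  rintro c c' hc ⟨u, hu, h⟩
  exact ⟨u, hu, h.trans hc⟩

theorem powerSet_add {g : ι → Fin d → ℕ} {b : ι → κ} {n n' : κ → ℕ} {c c' : Fin d → ℕ}
    (hc : c ∈ powerSet g b n) (hc' : c' ∈ powerSet g b n') : c + c' ∈ powerSet g b (n + n') := by
  obtain ⟨u, hu, h⟩ := hc
  obtain ⟨v, hv, h'⟩ := hc'
  refine ⟨u + v, by rw [labelDegree_add, hu, hv], ?_⟩
  simp only [Pi.add_apply, add_smul, Finset.sum_add_distrib]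
  exact add_le_add h h'

theorem powerSet_succ_subset (g : ι → Fin d → ℕ) (b : ι → κ) (n : κ → ℕ) (k : κ) :
    powerSet g b (n + Pi.single k 1) ⊆ powerSet g b n := by
  classical
  rintro c ⟨u, hu, h⟩
  have h1 : labelDegree b u k ≠ 0 := by rw [hu]; simp
  obtain ⟨i, -, hi⟩ := Finset.exists_ne_zero_of_sum_ne_zero h1
  have hik : b i = k := by by_contra hne; simp [hne] at hi
  have hpos : 1 ≤ u i := by simp [hik] at hi; omega
  have hle : Pi.single i 1 ≤ u := by
    intro l
    by_cases hl : l = i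
    · subst hl; simpa using hpos
    · simp [hl]
  obtain ⟨v, rfl⟩ := exists_add_of_le hle
  rw [labelDegree_add, labelDegree_single, hik, add_comm] at hu
  refine ⟨v, add_right_cancel hu, le_trans ?_ h⟩
  exact Finset.sum_le_sum fun l _ => nsmul_le_nsmul_left zero_le (by simp)

theorem powerSet_add_subset [Fintype κ] (g : ι → Fin d → ℕ) (b : ι → κ) (n a : κ → ℕ) :
    powerSet g b (n + a) ⊆ powerSet g b n := by
  obtain ⟨N, hN⟩ : ∃ N, ∑ k, a k = N := ⟨_, rfl⟩
  induction N generalizing a with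
  | zero =>
    have : a = 0 := by
      ext k
      exact (Finset.sum_eq_zero_iff.1 hN) k (Finset.mem_univ k)
    simp [this]
  | succ N ih =>
    have h0 : ∑ k, a k ≠ 0 := by omega
    obtain ⟨k, -, hk⟩ := Finset.exists_ne_zero_of_sum_ne_zero h0
    have hle : Pi.single k 1 ≤ a := by
      intro l
      by_cases hl : l = k
      · subst hl; simpa using Nat.one_le_iff_ne_zero.2 hk
      · simp [hl]
    obtain ⟨a', rfl⟩ := exists_add_of_le hle
    rw [add_comm (Pi.single k 1), ← add_assoc]
    refine (powerSet_succ_subset g b _ k).trans (ih a' ?_)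
    simp only [Pi.add_apply, Finset.sum_add_distrib, Finset.sum_pi_single', Finset.mem_univ,
      if_true] at hN
    omega

theorem sum_labelDegree [Fintype κ] (b : ι → κ) (u : ι → ℕ) :
    ∑ k, labelDegree b u k = ∑ i, u i := by
  simp only [labelDegree]
  rw [Finset.sum_comm]
  simp

theorem smul_mem_powerSet [Fintype κ] {g : ι → Fin d → ℕ} {b : ι → κ} {B : ℕ}
    (hB : ∀ i j, g i j ≤ B) (hb : Function.Surjective b) (n : κ → ℕ) :
    (fun _ => B * ∑ k, n k) ∈ powerSet g b n := by
  classical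
  obtain ⟨f, hf⟩ := hb.hasRightInverse
  have hdeg : labelDegree b (∑ k, Pi.single (f k) (n k)) = n := by
    have : ∀ s : Finset κ, labelDegree b (∑ k ∈ s, Pi.single (f k) (n k)) =
        ∑ k ∈ s, Pi.single k (n k) := by
      intro s
      induction s using Finset.induction_on with
      | empty => ext; simp [labelDegree]
      | insert k s hk ih =>
        rw [Finset.sum_insert hk, Finset.sum_insert hk, labelDegree_add, ih, labelDegree_single, hf]
    rw [this]
    exact Finset.univ_sum_single n
  refine ⟨_, hdeg, fun j => ?_⟩
  rw [← hdeg, sum_labelDegree, Finset.mul_sum]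
  rw [Finset.sum_apply]
  refine Finset.sum_le_sum fun i _ => ?_
  simp only [Pi.smul_apply, smul_eq_mul, hdeg]
  rw [mul_comm]
  exact Nat.mul_le_mul_right _ (hB i j)

/-- An element of the zeroth truncation which is large in one coordinate lies in the power set. -/
theorem mem_powerSet_of_le [Fintype κ] {g : ι → Fin d → ℕ} {b : ι → κ} {B : ℕ} {k₀ : κ}
    (hB : ∀ i j, g i j ≤ B) (hx : ∀ j, ∃ i, b i = k₀ ∧ g i ≤ Pi.single j B) {n : κ → ℕ}
    {c : Fin d → ℕ} (hc : c ∈ powerSet g b (Function.update n k₀ 0)) {j : Fin d}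
    (hj : B * ∑ k, n k ≤ c j) : c ∈ powerSet g b n := by
  classical
  obtain ⟨u, hu, h⟩ := hc
  obtain ⟨i, hi, hg⟩ := hx j
  refine ⟨u + Pi.single i (n k₀), ?_, ?_⟩
  · rw [labelDegree_add, hu, labelDegree_single, hi]
    ext k
    by_cases hk : k = k₀
    · subst hk; simp
    · simp [hk]
  · simp only [Pi.add_apply, add_smul, Finset.sum_add_distrib, sum_single_smul]
    intro l
    by_cases hl : l = j
    · subst hl
      refine le_trans ?_ hj
      have hs : ∑ k, n k = ∑ i, u i + n k₀ := by
        rw [← sum_labelDegree b u, hu, ← Finset.add_sum_erase _ n (Finset.mem_univ k₀),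
          ← Finset.add_sum_erase _ (Function.update n k₀ 0) (Finset.mem_univ k₀)]
        rw [Finset.sum_congr rfl fun k hk =>
          Function.update_of_ne (Finset.ne_of_mem_erase hk) 0 n]
        simp [add_comm]
      rw [hs, mul_add, Finset.mul_sum]
      simp only [Pi.add_apply, Finset.sum_apply, Pi.smul_apply, smul_eq_mul]
      refine add_le_add (Finset.sum_le_sum fun i _ => ?_) ?_
      · rw [mul_comm]; exact Nat.mul_le_mul_right _ (hB i l)
      · rw [mul_comm]; exact Nat.mul_le_mul_right _ (hB i l)
    · have h0 : g i l = 0 := by simpa [hl] using hg l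
      simpa [h0] using h l

theorem exists_powerSet_section {g : ι → Fin d → ℕ} {b : ι → κ} {B : ℕ} {k₀ : κ}
    (hx : ∀ j, ∃ i, b i = k₀ ∧ g i ≤ Pi.single j B) :
    ∃ (M : ℕ) (wt : Fin M → Option κ) (D : Set (Fin M → ℕ)) (φ : (Fin M → ℕ) → Fin d → ℕ),
      IsLowerSet D ∧ (∀ i, wt i = none → ∃ L, ∀ u ∈ D, u i < L) ∧
      ∀ n, Set.BijOn φ {u ∈ D | blockDegree wt u = n}
        (powerSet g b n \ powerSet g b (n + Pi.single k₀ 1)) := by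
  classical
  set e := Fintype.equivFin (ι ⊕ Fin d) with he
  set G : ι ⊕ Fin d → Fin d → ℕ := Sum.elim g (fun j => Pi.single j 1) with hG
  set w : ι ⊕ Fin d → Option κ := Sum.elim (fun i => some (b i)) (fun _ => none) with hw
  set wt : Fin (Fintype.card (ι ⊕ Fin d)) → Option κ := fun i => w (e.symm i) with hwt
  let φ : (Fin (Fintype.card (ι ⊕ Fin d)) → ℕ) →+ (Fin d → ℕ) × (κ → ℕ) :=
    { toFun := fun u => (∑ i, u i • G (e.symm i), blockDegree wt u)
      map_zero' := by
        refine Prod.ext (by simp) ?_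
        ext k; simp [blockDegree]
      map_add' := fun u v => by
        refine Prod.ext (by simp [add_smul, Finset.sum_add_distrib]) ?_
        ext k
        simp only [blockDegree, Pi.add_apply, Prod.snd_add, ← Finset.sum_add_distrib]
        exact Finset.sum_congr rfl fun i _ => by split_ifs <;> simp }
  have hsum : ∀ u : Fin (Fintype.card (ι ⊕ Fin d)) → ℕ, ∑ i, u i • G (e.symm i) =
      ∑ i, u (e (.inl i)) • g i + fun j => u (e (.inr j)) := by
    intro u
    rw [← e.sum_comp, Fintype.sum_sum_type]
    simp only [Equiv.symm_apply_apply, hG, Sum.elim_inl, Sum.elim_inr]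
    congr 1
    ext j
    simp [Finset.sum_apply, Pi.single_apply]
  have hdeg : ∀ u, blockDegree wt u = labelDegree b (fun i => u (e (.inl i))) := by
    intro u
    ext k
    rw [blockDegree, ← e.sum_comp, Fintype.sum_sum_type]
    simp [hwt, hw, labelDegree]
  have hφ : ∀ u, φ u = (∑ i, u (e (.inl i)) • g i + fun j => u (e (.inr j)),
      labelDegree b (fun i => u (e (.inl i)))) := fun u => by
    rw [← hsum, ← hdeg]; rfl
  have hrange : ∀ x : (Fin d → ℕ) × (κ → ℕ), x ∈ Set.range φ ↔ x.1 ∈ powerSet g b x.2 := by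
    rintro ⟨c, n⟩
    constructor
    · rintro ⟨u, hu⟩
      rw [hφ] at hu
      obtain ⟨h1, h2⟩ := Prod.ext_iff.1 hu
      exact ⟨_, h2, by rw [← h1]; exact le_self_add⟩
    · rintro ⟨u, hu, hle⟩
      obtain ⟨r, hr⟩ := exists_add_of_le hle
      refine ⟨fun i => Sum.elim u r (e.symm i), ?_⟩
      rw [hφ]
      simp only [Equiv.symm_apply_apply, Sum.elim_inl, Sum.elim_inr]
      exact Prod.ext hr.symm hu
  obtain ⟨D, hD, hinj, himg⟩ := exists_lowerSet_section φ
    {x | x.1 ∈ powerSet g b (x.2 + Pi.single k₀ 1)} (by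
      rintro u ⟨c, n⟩ hx
      have h := powerSet_add ((hrange (φ u)).1 ⟨u, rfl⟩) hx
      rw [← add_assoc] at h
      exact h)
  refine ⟨_, wt, D, fun u => (φ u).1, hD, ?_, ?_⟩
  · intro i hi
    refine ⟨B, fun u hu => ?_⟩
    by_contra! hle
    obtain ⟨x, rfl⟩ := e.surjective i
    rcases x with x | j
    · simp [hwt, hw] at hi
    · have hmem : Pi.single (e (.inr j)) B ∈ D := hD (fun l => by
        by_cases hl : l = e (.inr j)
        · subst hl; simpa using hle
        · simp [hl]) hu
      have hnot := (himg.subset ⟨_, hmem, rfl⟩).2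
      refine hnot ?_
      obtain ⟨i, hi, hg⟩ := hx j
      rw [hφ]
      refine ⟨Pi.single i 1, ?_, ?_⟩
      · rw [labelDegree_single, hi]
        ext k
        simp [labelDegree]
      · rw [sum_single_smul, one_smul]
        refine hg.trans fun l => ?_
        by_cases hl : l = j
        · subst hl; simp
        · simp [hl]
  · intro n
    refine ⟨?_, ?_, ?_⟩
    · rintro u ⟨hu, rfl⟩
      have h := himg.subset ⟨u, hu, rfl⟩
      exact ⟨(hrange _).1 h.1, h.2⟩
    · rintro u ⟨hu, hun⟩ v ⟨hv, hvn⟩ huv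
      exact hinj hu hv (Prod.ext huv (hun.trans hvn.symm))
    · rintro c ⟨hc, hc'⟩
      obtain ⟨u, hu, huc⟩ := himg.superset (⟨(hrange (c, n)).2 hc, hc'⟩ :
        (c, n) ∈ Set.range φ \ {x | x.1 ∈ powerSet g b (x.2 + Pi.single k₀ 1)})
      obtain ⟨h1, h2⟩ := Prod.ext_iff.1 huc
      exact ⟨u, ⟨hu, h2⟩, h1⟩

variable [Fintype κ]

theorem ncard_powerSet_diff_mem_stanleyCone {g : ι → Fin d → ℕ} {b : ι → κ} {B : ℕ} {k₀ : κ}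
    (hx : ∀ j, ∃ i, b i = k₀ ∧ g i ≤ Pi.single j B) :
    (fun n => (powerSet g b n \ powerSet g b (n + Pi.single k₀ 1)).ncard) ∈ stanleyCone κ := by
  obtain ⟨M, wt, D, φ, hD, hb, hφ⟩ := exists_powerSet_section hx
  convert ncard_fiber_mem_stanleyCone wt D hD hb using 1
  ext n
  rw [← (hφ n).image_eq, (hφ n).injOn.ncard_image]

theorem ncard_diff_eq_sum {α : Type*} (P : ℕ → Set α) (hP : ∀ k, P (k + 1) ⊆ P k) (N : ℕ)
    (hfin : ∀ k, (P 0 \ P k).Finite) :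
    (P 0 \ P N).ncard = ∑ k ∈ Finset.range N, (P k \ P (k + 1)).ncard := by
  have hanti : Antitone P := antitone_nat_of_succ_le hP
  induction N with
  | zero => simp
  | succ N ih =>
    rw [Finset.sum_range_succ, ← ih, ← Set.ncard_union_eq _ (hfin N)
      ((hfin (N + 1)).subset (Set.sdiff_subset_sdiff_left (hanti (Nat.zero_le N))))]
    · rw [Set.sdiff_union_sdiff_cancel (hanti (Nat.zero_le N)) (hP N)]
    · exact Set.disjoint_left.2 fun x hx hx' => hx.2 hx'.1

theorem finite_box (M : ℕ) : {c : Fin d → ℕ | ∀ j, c j < M}.Finite :=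
  (Set.finite_Iic (fun _ => M)).subset fun _ hc j => (hc j).le

theorem ncard_powerSet_update_mem_stanleyCone {g : ι → Fin d → ℕ} {b : ι → κ} {B : ℕ} {k₀ : κ}
    (hB : ∀ i j, g i j ≤ B) (hx : ∀ j, ∃ i, b i = k₀ ∧ g i ≤ Pi.single j B) :
    (fun n => (powerSet g b (Function.update n k₀ 0) \ powerSet g b n).ncard) ∈ stanleyCone κ := by
  convert shiftHom_mem k₀ (cumHom_mem k₀ (ncard_powerSet_diff_mem_stanleyCone hx)) using 1
  ext n
  have hstep : ∀ k, Function.update n k₀ k + Pi.single k₀ 1 = Function.update n k₀ (k + 1) := by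
    intro k
    ext l
    by_cases hl : l = k₀
    · subst hl; simp
    · simp [hl]
  have h := ncard_diff_eq_sum (fun k => powerSet g b (Function.update n k₀ k)) (fun k => by
    rw [← hstep]; exact powerSet_succ_subset g b _ k₀) (n k₀) (fun k => by
      refine (finite_box (B * ∑ l, Function.update n k₀ k l)).subset fun c hc j => ?_
      by_contra! hle
      refine hc.2 (mem_powerSet_of_le hB hx ?_ hle)
      rw [Function.update_idem]
      exact hc.1)
  rw [Function.update_eq_self] at h
  rw [h]
  simp only [shiftHom, cumHom, AddMonoidHom.coe_mk, ZeroHom.coe_mk, Function.update_self,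
    Function.update_idem]
  split_ifs with h0
  · simp [h0]
  · rw [Nat.sub_add_cancel (Nat.one_le_iff_ne_zero.2 h0), ← Finset.sum_range_reflect]
    exact Finset.sum_congr rfl fun k _ => by rw [hstep]

end PowerSet

section Asymptotics

open Topology

theorem tendsto_simplexCount (v s : ℕ) {x : ℕ → ℕ} {ν : ℝ} (hx : Tendsto x atTop atTop)
    (hν : Tendsto (fun m => (x m : ℝ) / m) atTop (𝓝 ν)) :
    Tendsto (fun m : ℕ => (simplexCount v (s + 1) (x m) : ℝ) / (m : ℝ) ^ s) atTop
      (𝓝 (ν ^ s / s.factorial)) := by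
  have hy : Tendsto (fun m => x m - v + s) atTop atTop :=
    tendsto_atTop_mono (fun m => Nat.le_add_right _ _) ((tendsto_sub_atTop_nat v).comp hx)
  have hev : ∀ᶠ m in atTop, v ≤ x m := hx.eventually_ge_atTop v
  have hyν : Tendsto (fun m => ((x m - v + s : ℕ) : ℝ) / m) atTop (𝓝 ν) := by
    have h2 := hν.add (tendsto_const_div_atTop_nhds_zero_nat ((s : ℝ) - v))
    rw [add_zero] at h2
    refine h2.congr' ?_
    filter_upwards [hev] with m hm
    push_cast [Nat.cast_sub hm]
    ring
  have heq := ((isEquivalent_choose s).comp_tendsto hy).div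
    (Asymptotics.IsEquivalent.refl (u := fun m : ℕ => (m : ℝ) ^ s))
  have hlim : Tendsto (fun m : ℕ => ((x m - v + s : ℕ) : ℝ) ^ s / s.factorial / (m : ℝ) ^ s) atTop
      (𝓝 (ν ^ s / s.factorial)) := by
    refine ((hyν.pow s).div_const _).congr fun m => ?_
    rw [div_pow]
    ring
  refine (heq.symm.tendsto_nhds hlim).congr' ?_
  filter_upwards [hev] with m hm
  simp [simplexCount, hm]

theorem tendsto_natSqrt : Tendsto Nat.sqrt atTop atTop :=
  tendsto_atTop_atTop.2 fun b => ⟨b * b, fun _ ha => Nat.le_sqrt.2 ha⟩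

theorem tendsto_natSqrt_div : Tendsto (fun m : ℕ => (Nat.sqrt m : ℝ) / m) atTop (𝓝 0) := by
  refine squeeze_zero (fun m => by positivity) (fun m => ?_)
    ((tendsto_one_div_atTop_nhds_zero_nat (𝕜 := ℝ)).comp tendsto_natSqrt)
  simp only [Function.comp]
  rcases Nat.eq_zero_or_pos m with h | h
  · simp [h]
  · have h1 : (0 : ℝ) < Nat.sqrt m := by exact_mod_cast Nat.sqrt_pos.2 h
    rw [div_le_div_iff₀ (by exact_mod_cast h) h1, one_mul]
    exact_mod_cast Nat.sqrt_le m

variable {κ : Type*}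

/-- A sequence asymptotic to the ray through `n` and with all coordinates unbounded. -/
def sqrtRay (n : κ → ℕ) (m : ℕ) : κ → ℕ := fun k => m * n k + Nat.sqrt m

theorem tendsto_sqrtRay (n : κ → ℕ) (k : κ) : Tendsto (fun m => sqrtRay n m k) atTop atTop :=
  tendsto_atTop_mono (fun _ => Nat.le_add_left _ _) tendsto_natSqrt

theorem tendsto_sqrtRay_div (n : κ → ℕ) (k : κ) :
    Tendsto (fun m => (sqrtRay n m k : ℝ) / m) atTop (𝓝 (n k)) := by
  have h := (tendsto_const_nhds (x := (n k : ℝ))).add tendsto_natSqrt_div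
  rw [add_zero] at h
  refine h.congr' ?_
  filter_upwards [eventually_ne_atTop 0] with m hm
  have : (m : ℝ) ≠ 0 := by exact_mod_cast hm
  simp only [sqrtRay]
  push_cast
  field_simp

variable [Fintype κ]

theorem tendsto_stanleyCount (v s : κ → ℕ) (n : κ → ℕ) :
    Tendsto (fun m : ℕ => (stanleyCount v (fun k => s k + 1) (sqrtRay n m) : ℝ) /
      (m : ℝ) ^ (∑ k, s k)) atTop (𝓝 (∏ k, ((n k : ℝ) ^ s k / (s k).factorial))) := by
  have h := tendsto_finsetProd Finset.univ fun k _ =>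
    tendsto_simplexCount (v k) (s k) (tendsto_sqrtRay n k) (tendsto_sqrtRay_div n k)
  refine h.congr fun m => ?_
  rw [Finset.prod_div_distrib, Finset.prod_pow_eq_pow_sum, stanleyCount]
  push_cast
  rfl

theorem eventually_stanleyCount_eq_zero (v s : κ → ℕ) {k : κ} (hk : s k = 0) (n : κ → ℕ) :
    ∀ᶠ m in atTop, stanleyCount v s (sqrtRay n m) = 0 := by
  filter_upwards [(tendsto_sqrtRay n k).eventually_gt_atTop (v k)] with m hm
  refine Finset.prod_eq_zero (Finset.mem_univ k) ?_
  simp [hk, hm.ne', simplexCount]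

/-- `G` is homogeneous of degree `d` with nonnegative coefficients. -/
def IsNonnegForm (d : ℕ) (G : MvPolynomial κ ℝ) : Prop :=
  G.IsHomogeneous d ∧ ∀ e, 0 ≤ G.coeff e

theorem exists_form_of_stanleyCount (d : ℕ) (v s : κ → ℕ)
    (hC : ∃ C : ℝ, ∀ m : ℕ, (stanleyCount v s (sqrtRay 1 m) : ℝ) ≤ C * (m : ℝ) ^ d) :
    ∃ G : MvPolynomial κ ℝ, IsNonnegForm d G ∧ ∀ n : κ → ℕ,
      Tendsto (fun m : ℕ => (stanleyCount v s (sqrtRay n m) : ℝ) / (m : ℝ) ^ d) atTop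
        (𝓝 (eval (fun k => (n k : ℝ)) G)) := by
  classical
  have hzero : IsNonnegForm d (0 : MvPolynomial κ ℝ) :=
    ⟨isHomogeneous_zero _ _ _, fun e => by simp⟩
  by_cases hs : ∃ k, s k = 0
  · obtain ⟨k, hk⟩ := hs
    refine ⟨0, hzero, fun n => ?_⟩
    rw [map_zero]
    refine tendsto_const_nhds.congr' ?_
    filter_upwards [eventually_stanleyCount_eq_zero v s hk n] with m hm
    simp [hm]
  push Not at hs
  obtain ⟨t, rfl⟩ : ∃ t : κ → ℕ, s = fun k => t k + 1 :=
    ⟨fun k => s k - 1, by ext k; have := hs k; dsimp only; omega⟩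
  have hpow : ∀ {a b : ℕ}, a < b → Tendsto (fun m : ℕ => (m : ℝ) ^ a / (m : ℝ) ^ b) atTop (𝓝 0) :=
    fun h => (tendsto_pow_div_pow_atTop_zero h).comp tendsto_natCast_atTop_atTop
  rcases lt_trichotomy (∑ k, t k) d with h | h | h
  · refine ⟨0, hzero, fun n => ?_⟩
    have h1 := (tendsto_stanleyCount v t n).mul (hpow h)
    rw [mul_zero] at h1
    rw [map_zero]
    refine h1.congr' ?_
    filter_upwards [eventually_ne_atTop 0] with m hm
    have : (m : ℝ) ≠ 0 := by exact_mod_cast hm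
    field_simp
  · refine ⟨monomial (Finsupp.equivFunOnFinite.symm t) (∏ k, ((t k).factorial : ℝ)⁻¹), ⟨?_, ?_⟩, ?_⟩
    · refine isHomogeneous_monomial _ ?_
      rw [Finsupp.degree_eq_sum]
      simpa using h
    · intro e
      rw [coeff_monomial]
      split_ifs
      · positivity
      · exact le_rfl
    · intro n
      have h1 := tendsto_stanleyCount v t n
      rw [h] at h1
      convert h1 using 2
      rw [eval_monomial, Finsupp.prod_fintype _ _ (by simp), ← Finset.prod_mul_distrib]
      refine Finset.prod_congr rfl fun k _ => ?_
      simp [div_eq_mul_inv, mul_comm]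
  · exfalso
    obtain ⟨C, hC⟩ := hC
    have h1 := tendsto_stanleyCount v t 1
    have h2 := (hpow h).const_mul C
    rw [mul_zero] at h2
    have h3 := le_of_tendsto_of_tendsto' h1 h2 fun m => by
      rw [← mul_div_assoc]
      exact div_le_div_of_nonneg_right (hC m) (by positivity)
    have h4 : 0 < ∏ k, ((((1 : κ → ℕ) k : ℕ) : ℝ) ^ t k / (t k).factorial) :=
      Finset.prod_pos fun k _ => by simp; positivity
    exact absurd h3 (not_le.2 h4)

theorem exists_form_of_mem_stanleyCone (d : ℕ) {f : (κ → ℕ) → ℕ} (hf : f ∈ stanleyCone κ)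
    (hC : ∃ C : ℝ, ∀ m : ℕ, (f (sqrtRay 1 m) : ℝ) ≤ C * (m : ℝ) ^ d) :
    ∃ G : MvPolynomial κ ℝ, IsNonnegForm d G ∧ ∀ n : κ → ℕ,
      Tendsto (fun m : ℕ => (f (sqrtRay n m) : ℝ) / (m : ℝ) ^ d) atTop
        (𝓝 (eval (fun k => (n k : ℝ)) G)) := by
  induction hf using AddSubmonoid.closure_induction with
  | mem f hf =>
    obtain ⟨p, rfl⟩ := hf
    exact exists_form_of_stanleyCount d p.1 p.2 hC
  | zero =>
    refine ⟨0, ⟨isHomogeneous_zero _ _ _, fun e => by simp⟩, fun n => ?_⟩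
    simp
  | add f g _ _ hf hg =>
    obtain ⟨C, hC⟩ := hC
    simp only [Pi.add_apply, Nat.cast_add] at hC
    obtain ⟨G, hG, hG'⟩ := hf ⟨C, fun m => le_trans (by simp) (hC m)⟩
    obtain ⟨H, hH, hH'⟩ := hg ⟨C, fun m => le_trans (by simp) (hC m)⟩
    refine ⟨G + H, ⟨hG.1.add hH.1, fun e => ?_⟩, fun n => ?_⟩
    · rw [coeff_add]; exact add_nonneg (hG.2 e) (hH.2 e)
    · rw [map_add]
      refine ((hG' n).add (hH' n)).congr fun m => ?_
      rw [Pi.add_apply, Nat.cast_add, add_div]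

end Asymptotics

section PowerSetLimit

open Topology

theorem ncard_box (d M : ℕ) : {c : Fin d → ℕ | ∀ j, c j < M}.ncard = M ^ d := by
  have h : {c : Fin d → ℕ | ∀ j, c j < M} =
      ((Fintype.piFinset fun _ : Fin d => Finset.range M : Finset (Fin d → ℕ)) :
        Set (Fin d → ℕ)) := by
    ext c; simp
  rw [h, Set.ncard_coe_finset]
  simp

theorem ncard_inter_box_add_le {d : ℕ} {U U' : Set (Fin d → ℕ)} {M h : ℕ}
    (hU : ∀ c ∈ U, (c + fun _ => h) ∈ U') :
    (U ∩ {c | ∀ j, c j < M + h}).ncard + M ^ d ≤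
      (U' ∩ {c | ∀ j, c j < M + h}).ncard + (M + h) ^ d := by
  have h1 : (U ∩ {c | ∀ j, c j < M}).ncard ≤ (U' ∩ {c | ∀ j, c j < M + h}).ncard := by
    refine Set.ncard_le_ncard_of_injOn (fun c => c + fun _ => h) ?_ ?_
      ((finite_box _).subset Set.inter_subset_right)
    · rintro c ⟨hc, hc'⟩
      exact ⟨hU c hc, fun j => Nat.add_lt_add_right (hc' j) h⟩
    · intro c _ c' _ h; exact add_right_cancel h
  have h2 : (U ∩ {c | ∀ j, c j < M + h}).ncard ≤ (U ∩ {c | ∀ j, c j < M}).ncard +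
      ({c : Fin d → ℕ | ∀ j, c j < M + h} \ {c | ∀ j, c j < M}).ncard := by
    refine le_trans (Set.ncard_le_ncard (fun c hc => ?_)
      (((finite_box _).subset Set.inter_subset_right).union
        ((finite_box (M + h)).subset Set.sdiff_subset))) (Set.ncard_union_le _ _)
    by_cases hc' : c ∈ {c : Fin d → ℕ | ∀ j, c j < M}
    · exact Or.inl ⟨hc.1, hc'⟩
    · exact Or.inr ⟨hc.2, hc'⟩
  have h3 : ({c : Fin d → ℕ | ∀ j, c j < M + h} \ {c | ∀ j, c j < M}).ncard + M ^ d =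
      (M + h) ^ d := by
    rw [← ncard_box d M, ← ncard_box d (M + h)]
    exact Set.ncard_sdiff_add_ncard_of_subset (fun c hc j => (hc j).trans_le (Nat.le_add_right _ _))
      (finite_box _)
  omega

theorem ncard_diff_add_ncard_inter_box {d : ℕ} {U U' : Set (Fin d → ℕ)} {M : ℕ} (hU : U' ⊆ U)
    (hbox : ∀ c ∈ U \ U', ∀ j, c j < M) :
    (U \ U').ncard + (U' ∩ {c | ∀ j, c j < M}).ncard = (U ∩ {c | ∀ j, c j < M}).ncard := by
  rw [← Set.ncard_union_eq ?_ ((finite_box M).subset hbox)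
    ((finite_box M).subset Set.inter_subset_right)]
  · congr 1
    ext c
    by_cases hc : c ∈ U'
    · simp [hc, hU hc]
    · simp only [Set.mem_union, Set.mem_sdiff, Set.mem_inter_iff, hc, false_and, or_false,
        not_false_iff, and_true]
      exact ⟨fun h => ⟨h, hbox c ⟨h, hc⟩⟩, fun h => h.1⟩
  · exact Set.disjoint_left.2 fun c hc hc' => hc.2 hc'.1

variable {κ ι : Type*} [DecidableEq κ] [Fintype κ] [Fintype ι] {d : ℕ}

theorem powerSet_subset_update (g : ι → Fin d → ℕ) (b : ι → κ) (n : κ → ℕ) (k₀ : κ) :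
    powerSet g b n ⊆ powerSet g b (Function.update n k₀ 0) := by
  have h : n = Function.update n k₀ 0 + Pi.single k₀ (n k₀) := by
    ext l
    by_cases hl : l = k₀
    · subst hl; simp
    · simp [hl]
  conv_lhs => rw [h]
  exact powerSet_add_subset g b _ _

theorem add_mem_powerSet_add {g : ι → Fin d → ℕ} {b : ι → κ} {B : ℕ} (hB : ∀ i j, g i j ≤ B)
    (hb : Function.Surjective b) {n a : κ → ℕ} {h : ℕ} (ha : B * ∑ k, a k ≤ h)
    {c : Fin d → ℕ} (hc : c ∈ powerSet g b n) : (c + fun _ => h) ∈ powerSet g b (n + a) :=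
  powerSet_isUpperSet g b _ (add_le_add le_rfl fun _ => ha)
    (powerSet_add hc (smul_mem_powerSet hB hb a))

theorem exists_form_powerSet {g : ι → Fin d → ℕ} {b : ι → κ} {B : ℕ} {k₀ : κ}
    (hB : ∀ i j, g i j ≤ B) (hb : Function.Surjective b)
    (hx : ∀ j, ∃ i, b i = k₀ ∧ g i ≤ Pi.single j B) :
    ∃ G : MvPolynomial κ ℝ, IsNonnegForm d G ∧ ∀ n : κ → ℕ,
      Tendsto (fun m : ℕ =>
        ((powerSet g b (Function.update (m • n) k₀ 0) \ powerSet g b (m • n)).ncard : ℝ) /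
          (m : ℝ) ^ d) atTop (𝓝 (eval (fun k => (n k : ℝ)) G)) := by
  set H : (κ → ℕ) → ℕ :=
    fun n => (powerSet g b (Function.update n k₀ 0) \ powerSet g b n).ncard with hH
  have hbox : ∀ n : κ → ℕ, ∀ c ∈ powerSet g b (Function.update n k₀ 0) \ powerSet g b n,
      ∀ j, c j < B * ∑ k, n k := by
    intro n c hc j
    by_contra! hle
    exact hc.2 (mem_powerSet_of_le hB hx hc.1 hle)
  obtain ⟨G, hG, hlim⟩ := exists_form_of_mem_stanleyCone d
    (ncard_powerSet_update_mem_stanleyCone hB hx) (by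
      refine ⟨((B * Fintype.card κ * 2 : ℕ) : ℝ) ^ d, fun m => ?_⟩
      have h1 : H (sqrtRay 1 m) ≤ (B * Fintype.card κ * 2 * m) ^ d := by
        refine (Set.ncard_le_ncard (t := {c : Fin d → ℕ | ∀ j, c j < B * ∑ k, sqrtRay 1 m k})
          (hbox (sqrtRay 1 m))
          (finite_box _)).trans ?_
        rw [ncard_box]
        refine Nat.pow_le_pow_left ?_ d
        simp only [sqrtRay, Pi.one_apply, Finset.sum_const, Finset.card_univ, smul_eq_mul,
          mul_one]
        have := Nat.sqrt_le_self m
        nlinarith [Nat.zero_le (B * Fintype.card κ), Nat.mul_le_mul_left (B * Fintype.card κ) this]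
      rw [← mul_pow]
      exact_mod_cast h1)
  refine ⟨G, hG, fun n => ?_⟩
  set N := ∑ k, n k
  set K := Fintype.card κ
  have hsum : ∀ m, B * ∑ k, sqrtRay n m k = B * (m * N) + B * (K * Nat.sqrt m) := by
    intro m
    simp only [sqrtRay, Finset.sum_add_distrib, ← Finset.mul_sum, Finset.sum_const,
      Finset.card_univ, smul_eq_mul]
    ring
  have hray : ∀ m, sqrtRay n m = m • n + fun _ => Nat.sqrt m := fun m => by
    ext k; simp [sqrtRay]
  have hkey : ∀ m : ℕ, |(H (m • n) : ℝ) - H (sqrtRay n m)| ≤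
      ((B * (m * N) + B * (K * Nat.sqrt m) : ℕ) : ℝ) ^ d - ((B * (m * N) : ℕ) : ℝ) ^ d := by
    intro m
    set M := B * (m * N)
    set h := B * (K * Nat.sqrt m)
    have hsub := fun n' : κ → ℕ => powerSet_subset_update g b n' k₀
    have e1 := ncard_diff_add_ncard_inter_box (M := M + h) (hsub (m • n)) fun c hc j =>
      (hbox _ c hc j).trans_le (by simp [M, N, ← Finset.mul_sum])
    have e2 := ncard_diff_add_ncard_inter_box (M := M + h) (hsub (sqrtRay n m)) fun c hc j =>
      (hbox _ c hc j).trans_le (hsum m).le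
    have l1 := ncard_inter_box_add_le (U := powerSet g b (m • n))
      (U' := powerSet g b (sqrtRay n m)) (M := M) (h := h) fun c hc => by
        rw [hray]
        exact add_mem_powerSet_add hB hb (by simp [h, K]) hc
    have hupd : Function.update (sqrtRay n m) k₀ 0 =
        Function.update (m • n) k₀ 0 + Function.update (fun _ => Nat.sqrt m) k₀ 0 := by
      ext k
      by_cases hk : k = k₀
      · subst hk; simp
      · simp [hk, hray]
    have l2 := ncard_inter_box_add_le (U := powerSet g b (Function.update (m • n) k₀ 0))
      (U' := powerSet g b (Function.update (sqrtRay n m) k₀ 0)) (M := M) (h := h) fun c hc => by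
        rw [hupd]
        refine add_mem_powerSet_add hB hb (Nat.mul_le_mul_left _ ?_) hc
        have : ∑ k, Function.update (fun _ : κ => Nat.sqrt m) k₀ 0 k ≤
            ∑ _k : κ, Nat.sqrt m := Finset.sum_le_sum fun k _ => by
          by_cases hk : k = k₀
          · subst hk; simp
          · simp [hk]
        simpa [K] using this
    have l3 : (powerSet g b (sqrtRay n m) ∩ {c | ∀ j, c j < M + h}).ncard ≤
        (powerSet g b (m • n) ∩ {c | ∀ j, c j < M + h}).ncard :=
      Set.ncard_le_ncard (Set.inter_subset_inter_left _ (by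
        rw [hray]; exact powerSet_add_subset g b _ _))
        ((finite_box _).subset Set.inter_subset_right)
    have l4 : (powerSet g b (Function.update (sqrtRay n m) k₀ 0) ∩
          {c | ∀ j, c j < M + h}).ncard ≤
        (powerSet g b (Function.update (m • n) k₀ 0) ∩ {c | ∀ j, c j < M + h}).ncard :=
      Set.ncard_le_ncard (Set.inter_subset_inter_left _ (by
        rw [hupd]; exact powerSet_add_subset g b _ _))
        ((finite_box _).subset Set.inter_subset_right)
    rw [abs_le]
    simp only [hH]
    have e1' := congrArg (Nat.cast (R := ℝ)) e1
    have e2' := congrArg (Nat.cast (R := ℝ)) e2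
    have l1' := (Nat.cast_le (α := ℝ)).2 l1
    have l2' := (Nat.cast_le (α := ℝ)).2 l2
    have l3' := (Nat.cast_le (α := ℝ)).2 l3
    have l4' := (Nat.cast_le (α := ℝ)).2 l4
    push_cast at e1' e2' l1' l2' l3' l4' ⊢
    constructor <;> linarith
  have hδ : Tendsto (fun m : ℕ => (((B * (m * N) + B * (K * Nat.sqrt m) : ℕ) : ℝ) ^ d -
      ((B * (m * N) : ℕ) : ℝ) ^ d) / (m : ℝ) ^ d) atTop (𝓝 0) := by
    have h1 : Tendsto (fun m : ℕ => ((B : ℝ) * N + B * K * ((Nat.sqrt m : ℝ) / m)) ^ d -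
        ((B : ℝ) * N) ^ d) atTop (𝓝 (((B : ℝ) * N + B * K * 0) ^ d - ((B : ℝ) * N) ^ d)) :=
      (((tendsto_natSqrt_div.const_mul _).const_add _).pow d).sub_const _
    rw [mul_zero, add_zero, sub_self] at h1
    refine h1.congr' ?_
    filter_upwards [eventually_ne_atTop 0] with m hm
    have : (m : ℝ) ≠ 0 := by exact_mod_cast hm
    rw [sub_div, ← div_pow, ← div_pow]
    push_cast
    congr 2 <;> field_simp
  have hdiff : Tendsto (fun m : ℕ => (H (m • n) : ℝ) / (m : ℝ) ^ d -
      (H (sqrtRay n m) : ℝ) / (m : ℝ) ^ d) atTop (𝓝 0) := by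
    refine squeeze_zero_norm (fun m => ?_) hδ
    rw [← sub_div, norm_div, Real.norm_eq_abs, Real.norm_of_nonneg (by positivity)]
    exact div_le_div_of_nonneg_right (hkey m) (by positivity)
  have := hdiff.add (hlim n)
  simpa [H] using this

end PowerSetLimit

section LimitBody

open Topology

variable {d : ℕ}

/-- The union of the rescaled upper sets `(p * q)⁻¹ • (A q + ℝ≥0^d)` over `q > 0`. -/
def limitBody (p : ℕ) (A : ℕ → Set (Fin d → ℕ)) : Set (Fin d → ℝ) :=
  {x | ∃ q : ℕ, 0 < q ∧ ∃ a ∈ A q, ∀ j, (a j : ℝ) ≤ p * q * x j}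

theorem limitBody_isUpperSet (p : ℕ) (A : ℕ → Set (Fin d → ℕ)) : IsUpperSet (limitBody p A) := by
  rintro x y hxy ⟨q, hq, a, ha, h⟩
  exact ⟨q, hq, a, ha, fun j => (h j).trans (mul_le_mul_of_nonneg_left (hxy j) (by positivity))⟩

theorem measurableSet_limitBody (p : ℕ) (A : ℕ → Set (Fin d → ℕ)) :
    MeasurableSet (limitBody p A) := by
  have h : limitBody p A = ⋃ q : ℕ, ⋃ a : Fin d → ℕ, ⋃ _ : 0 < q ∧ a ∈ A q,
      {x | ∀ j, (a j : ℝ) ≤ p * q * x j} := by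
    ext x
    simp only [limitBody, Set.mem_ofPred_eq, Set.mem_iUnion]
    constructor
    · rintro ⟨q, hq, a, ha, h⟩; exact ⟨q, a, ⟨hq, ha⟩, h⟩
    · rintro ⟨q, a, ⟨hq, ha⟩, h⟩; exact ⟨q, hq, a, ha, h⟩
  rw [h]
  refine MeasurableSet.iUnion fun q => MeasurableSet.iUnion fun a => MeasurableSet.iUnion fun _ => ?_
  rw [Set.ofPred_forall]
  exact MeasurableSet.iInter fun j => measurableSet_le (by fun_prop) (by fun_prop)

/-- The half-open cell of side `1 / N` with lower corner `c / N`. -/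
def cell (N : ℕ) (c : Fin d → ℕ) : Set (Fin d → ℝ) :=
  Set.univ.pi fun j => Set.Ico ((c j : ℝ) / N) ((c j + 1) / N)

theorem mem_cell {N : ℕ} (hN : 0 < N) {c : Fin d → ℕ} {x : Fin d → ℝ} :
    x ∈ cell N c ↔ ∀ j, (c j : ℝ) ≤ N * x j ∧ N * x j < c j + 1 := by
  have : (0 : ℝ) < N := by exact_mod_cast hN
  simp only [cell, Set.mem_univ_pi, Set.mem_Ico, div_le_iff₀' this, lt_div_iff₀' this]

theorem measurableSet_cell (N : ℕ) (c : Fin d → ℕ) : MeasurableSet (cell N c) :=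
  MeasurableSet.univ_pi fun _ => measurableSet_Ico

theorem volume_biUnion_cell {N : ℕ} (hN : 0 < N) {T : Set (Fin d → ℕ)} (hT : T.Finite) :
    volume.real (⋃ c ∈ T, cell N c) = (T.ncard : ℝ) / (N : ℝ) ^ d := by
  have hN' : (0 : ℝ) < N := by exact_mod_cast hN
  obtain ⟨T, rfl⟩ := hT.exists_finset_coe
  have hdisj : Set.PairwiseDisjoint (T : Set (Fin d → ℕ)) (cell N) := by
    intro c _ c' _ hne
    refine Set.disjoint_left.2 fun x hx hx' => hne ?_
    rw [mem_cell hN] at hx hx'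
    ext j
    have h1 : (c j : ℝ) < c' j + 1 := (hx j).1.trans_lt (hx' j).2
    have h2 : (c' j : ℝ) < c j + 1 := (hx' j).1.trans_lt (hx j).2
    norm_cast at h1 h2
    omega
  have hcell : ∀ c : Fin d → ℕ, volume (cell N c) = ENNReal.ofReal ((1 / N : ℝ) ^ d) := by
    intro c
    rw [cell, Real.volume_pi_Ico]
    have : ∀ j, ((c j + 1 : ℝ) / N - c j / N) = 1 / N := fun j => by ring
    simp only [this, Finset.prod_const, Finset.card_univ, Fintype.card_fin]
    rw [ENNReal.ofReal_pow (by positivity)]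
  simp only [Finset.mem_coe]
  rw [Measure.real, measure_biUnion_finset hdisj fun c _ => measurableSet_cell N c]
  simp only [hcell, Finset.sum_const, Set.ncard_coe_finset, nsmul_eq_mul]
  rw [ENNReal.toReal_mul, ENNReal.toReal_ofReal (by positivity)]
  simp [div_eq_mul_inv]

theorem smul_mem_of_add_mem {A : ℕ → Set (Fin d → ℕ)}
    (hadd : ∀ i j, ∀ a ∈ A i, ∀ b ∈ A j, a + b ∈ A (i + j)) {q : ℕ} {a : Fin d → ℕ}
    (ha : a ∈ A q) (k : ℕ) : (k + 1) • a ∈ A ((k + 1) * q) := by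
  induction k with
  | zero => simpa using ha
  | succ k ih =>
    rw [succ_nsmul, Nat.succ_mul]
    exact hadd _ _ _ ih _ ha

theorem eventually_exists_mem_of_mem_interior {p : ℕ} (hp : 0 < p) {A : ℕ → Set (Fin d → ℕ)}
    (hne : ∀ q, (A q).Nonempty) (hadd : ∀ i j, ∀ a ∈ A i, ∀ b ∈ A j, a + b ∈ A (i + j))
    {x : Fin d → ℝ} (hx : x ∈ interior (limitBody p A)) :
    ∀ᶠ q : ℕ in atTop, ∃ c ∈ A q, ∀ j, (c j : ℝ) ≤ p * q * x j := by
  have hp' : (0 : ℝ) < p := by exact_mod_cast hp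
  obtain ⟨ε, hε, q₀, hq₀, a, ha, hax⟩ : ∃ ε > 0, (fun j => x j - ε) ∈ limitBody p A := by
    have hcont : Tendsto (fun ε : ℝ => fun j => x j - ε) (𝓝[>] 0) (𝓝 x) := by
      have h : Continuous fun ε : ℝ => fun j => x j - ε := by fun_prop
      have h2 := h.tendsto 0
      simp only [sub_zero] at h2
      exact h2.mono_left nhdsWithin_le_nhds
    obtain ⟨ε, h1, h2⟩ := ((hcont.eventually (mem_interior_iff_mem_nhds.1 hx)).and
      self_mem_nhdsWithin).exists
    exact ⟨ε, h2, h1⟩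
  choose b hb using hne
  obtain ⟨C, hC⟩ : ∃ C : ℕ, ∀ s < q₀, ∀ j, b s j ≤ C := by
    refine ⟨∑ s ∈ Finset.range q₀, ∑ j, b s j, fun s hs j => ?_⟩
    exact (Finset.single_le_sum (f := b s) (fun _ _ => Nat.zero_le _) (Finset.mem_univ j)).trans
      (Finset.single_le_sum (f := fun s => ∑ j, b s j) (fun _ _ => Nat.zero_le _)
        (Finset.mem_range.2 hs))
  have hlarge : ∀ᶠ q : ℕ in atTop, (C : ℝ) ≤ p * q * ε :=
    ((tendsto_natCast_atTop_atTop.const_mul_atTop hp').atTop_mul_const hε).eventually_ge_atTop _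
  filter_upwards [hlarge, eventually_ge_atTop q₀] with q hq hqq
  obtain ⟨k, hk⟩ : ∃ k, q / q₀ = k + 1 :=
    Nat.exists_eq_succ_of_ne_zero (Nat.div_pos hqq hq₀).ne'
  have hdiv : (k + 1) * q₀ + q % q₀ = q := by rw [← hk]; exact Nat.div_add_mod' q q₀
  refine ⟨(k + 1) • a + b (q % q₀), ?_, fun j => ?_⟩
  · have := hadd _ _ _ (smul_mem_of_add_mem hadd ha k) _ (hb (q % q₀))
    rwa [hdiv] at this
  · have h1 : (b (q % q₀) j : ℝ) ≤ C := by exact_mod_cast hC _ (Nat.mod_lt _ hq₀) j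
    have hq₀' : (0 : ℝ) < q₀ := by exact_mod_cast hq₀
    have h2 : 0 ≤ x j - ε := by
      have : (0 : ℝ) ≤ p * q₀ * (x j - ε) := le_trans (by positivity) (hax j)
      exact nonneg_of_mul_nonneg_right this (by positivity)
    have h3 : ((k : ℝ) + 1) * q₀ ≤ q := by
      have : (k + 1) * q₀ ≤ q := by omega
      exact_mod_cast this
    have h4 : ((k : ℝ) + 1) * a j ≤ (k + 1) * (p * q₀ * (x j - ε)) :=
      mul_le_mul_of_nonneg_left (hax j) (by positivity)
    have h5 : ((k : ℝ) + 1) * q₀ * (p * (x j - ε)) ≤ q * (p * (x j - ε)) :=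
      mul_le_mul_of_nonneg_right h3 (by positivity)
    simp only [Pi.add_apply, Pi.smul_apply, smul_eq_mul]
    push_cast
    nlinarith

theorem limitBody_inter_box_subset {p : ℕ} (hp : 0 < p) (A : ℕ → Set (Fin d → ℕ)) (R : ℕ) :
    limitBody p A ∩ {x | ∀ j, x j < R} ⊆ Set.univ.pi fun _ => Set.Ico (0 : ℝ) R := by
  rintro x ⟨⟨q, hq, a, -, ha⟩, h2⟩ j _
  refine ⟨?_, h2 j⟩
  have h3 : (0 : ℝ) < p * q := by exact_mod_cast Nat.mul_pos hp hq
  exact nonneg_of_mul_nonneg_right ((Nat.cast_nonneg _).trans (ha j)) h3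

theorem volume_pi_Ico_ne_top (R : ℕ) :
    volume (Set.univ.pi fun _ : Fin d => Set.Ico (0 : ℝ) R) ≠ ⊤ := by
  rw [Real.volume_pi_Ico]
  exact ENNReal.prod_ne_top fun _ _ => ENNReal.ofReal_ne_top

theorem volume_limitBody_inter_box_ne_top {p : ℕ} (hp : 0 < p) (A : ℕ → Set (Fin d → ℕ)) (R : ℕ) :
    volume (limitBody p A ∩ {x | ∀ j, x j < R}) ≠ ⊤ :=
  measure_ne_top_of_subset (limitBody_inter_box_subset hp A R) (volume_pi_Ico_ne_top R)

theorem measurableSet_limitBody_inter_box (p : ℕ) (A : ℕ → Set (Fin d → ℕ)) (R : ℕ) :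
    MeasurableSet (limitBody p A ∩ {x | ∀ j, x j < R}) := by
  refine (measurableSet_limitBody p A).inter ?_
  rw [Set.ofPred_forall]
  exact MeasurableSet.iInter fun j => measurableSet_lt (by fun_prop) (by fun_prop)

theorem tendsto_ncard_inter_box (p : ℕ) (hp : 0 < p) (R : ℕ) {A : ℕ → Set (Fin d → ℕ)}
    (hup : ∀ q, IsUpperSet (A q)) (hne : ∀ q, (A q).Nonempty)
    (hadd : ∀ i j, ∀ a ∈ A i, ∀ b ∈ A j, a + b ∈ A (i + j)) :
    Tendsto (fun q : ℕ => ((A q ∩ {c | ∀ j, c j < R * (p * q)}).ncard : ℝ) /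
      ((p * q : ℕ) : ℝ) ^ d) atTop
      (𝓝 (volume.real (limitBody p A ∩ {x | ∀ j, x j < R}))) := by
  set S : ℕ → Set (Fin d → ℝ) := fun q =>
    ⋃ c ∈ A q ∩ {c | ∀ j, c j < R * (p * q)}, cell (p * q) c with hS
  have hfin : ∀ q, (A q ∩ {c : Fin d → ℕ | ∀ j, c j < R * (p * q)}).Finite := fun q =>
    (finite_box _).subset Set.inter_subset_right
  have hsub : ∀ q, 0 < q → S q ⊆ limitBody p A ∩ {x | ∀ j, x j < R} := by
    intro q hq x hx
    simp only [hS, Set.mem_iUnion] at hx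
    obtain ⟨c, ⟨hc, hcR⟩, hx⟩ := hx
    rw [mem_cell (Nat.mul_pos hp hq)] at hx
    refine ⟨⟨q, hq, c, hc, fun j => by simpa using (hx j).1⟩, fun j => ?_⟩
    have h1 : ((c j : ℝ) + 1) ≤ R * (p * q : ℕ) := by exact_mod_cast hcR j
    have h2 := (hx j).2.trans_le h1
    have h3 : (0 : ℝ) < (p * q : ℕ) := by exact_mod_cast Nat.mul_pos hp hq
    rw [mul_comm (R : ℝ)] at h2
    exact lt_of_mul_lt_mul_left h2 h3.le
  have hlim : Tendsto (fun q => volume (S q)) atTop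
      (𝓝 (volume (limitBody p A ∩ {x | ∀ j, x j < R}))) := by
    refine tendsto_measure_of_ae_tendsto_indicator atTop
      (measurableSet_limitBody_inter_box p A R)
      (fun q => (hfin q).measurableSet_biUnion fun c _ => measurableSet_cell _ c)
      (MeasurableSet.univ_pi fun _ => measurableSet_Ico) (volume_pi_Ico_ne_top R) ?_ ?_
    · filter_upwards [eventually_gt_atTop 0] with q hq
      exact (hsub q hq).trans (limitBody_inter_box_subset hp A R)
    · have hfr : volume (frontier (limitBody p A)) = 0 :=
        (limitBody_isUpperSet p A).null_frontier
      filter_upwards [measure_eq_zero_iff_ae_notMem.1 hfr] with x hx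
      by_cases hxD : x ∈ limitBody p A ∩ {x | ∀ j, x j < R}
      · have hxint : x ∈ interior (limitBody p A) := by
          by_contra h
          exact hx ⟨subset_closure hxD.1, h⟩
        filter_upwards [eventually_exists_mem_of_mem_interior hp hne hadd hxint,
          eventually_gt_atTop 0] with q hq hq0
        refine ⟨fun h => hsub q hq0 h, fun _ => ?_⟩
        obtain ⟨c, hc, hcx⟩ := hq
        have hpq : (0 : ℝ) < (p * q : ℕ) := by exact_mod_cast Nat.mul_pos hp hq0
        have hnn : ∀ j, 0 ≤ ((p * q : ℕ) : ℝ) * x j := fun j => by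
          push_cast; exact (Nat.cast_nonneg _).trans (hcx j)
        simp only [hS, Set.mem_iUnion]
        refine ⟨fun j => ⌊((p * q : ℕ) : ℝ) * x j⌋₊, ⟨hup q (fun j => ?_) hc, fun j => ?_⟩, ?_⟩
        · refine Nat.le_floor ?_
          push_cast
          exact hcx j
        · rw [Nat.floor_lt (hnn j)]
          push_cast
          rw [mul_comm (R : ℝ)]
          refine mul_lt_mul_of_pos_left (hxD.2 j) ?_
          exact_mod_cast hpq
        · rw [mem_cell (Nat.mul_pos hp hq0)]
          exact fun j => ⟨Nat.floor_le (hnn j), Nat.lt_floor_add_one _⟩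
      · filter_upwards [eventually_gt_atTop 0] with q hq0
        exact ⟨fun h => hsub q hq0 h, fun h => absurd h hxD⟩
  refine ((ENNReal.tendsto_toReal
    (volume_limitBody_inter_box_ne_top hp A R)).comp hlim).congr' ?_
  filter_upwards [eventually_gt_atTop 0] with q hq
  exact volume_biUnion_cell (Nat.mul_pos hp hq) (hfin q)

end LimitBody

section ExponentFamily

open Topology

variable {d : ℕ}

/-- The sets of exponents of a graded family of nonzero monomial ideals whose generators have
exponents growing at most linearly, with slope `β`. -/
structure IsExponentFamily (β : ℕ) (K : ℕ → Set (Fin d → ℕ)) : Prop where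
  isUpperSet : ∀ n, IsUpperSet (K n)
  zero : K 0 = Set.univ
  add : ∀ i j, ∀ a ∈ K i, ∀ b ∈ K j, a + b ∈ K (i + j)
  nonempty : ∀ n, (K n).Nonempty
  exists_le : ∀ n, ∀ c ∈ K n, ∃ a ∈ K n, a ≤ c ∧ ∀ j, a j ≤ β * n

theorem IsExponentFamily.smul_mem {β : ℕ} {K : ℕ → Set (Fin d → ℕ)} (hK : IsExponentFamily β K)
    {n : ℕ} {a : Fin d → ℕ} (ha : a ∈ K n) (t : ℕ) : t • a ∈ K (t * n) := by
  induction t with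
  | zero => simp [hK.zero]
  | succ t ih =>
    rw [succ_nsmul, Nat.succ_mul]
    exact hK.add _ _ _ ih _ ha

variable {κ : Type*}

theorem update_smul_zero [DecidableEq κ] (m : ℕ) (n : κ → ℕ) (k₀ : κ) :
    Function.update (m • n) k₀ 0 = m • Function.update n k₀ 0 := by
  ext k
  by_cases hk : k = k₀
  · subst hk; simp
  · simp [hk]

/-- The generators with exponents at most `B` of the `p`-th members of the families. -/
abbrev BoundedGenerator (K : κ → ℕ → Set (Fin d → ℕ)) (B p : ℕ) : Type _ :=
  {x : κ × (Fin d → Fin (B + 1)) // (fun j => (x.2 j : ℕ)) ∈ K x.1 p}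

namespace BoundedGenerator

variable {K : κ → ℕ → Set (Fin d → ℕ)}

/-- The exponent vector of a generator. -/
def exponent {B p : ℕ} (x : BoundedGenerator K B p) : Fin d → ℕ := fun j => x.1.2 j

/-- The family to which a generator belongs. -/
def label {B p : ℕ} (x : BoundedGenerator K B p) : κ := x.1.1

theorem exists_exponent_eq {B p : ℕ} {k : κ} {a : Fin d → ℕ} (ha : a ∈ K k p)
    (haB : ∀ j, a j ≤ B) : ∃ x : BoundedGenerator K B p, x.label = k ∧ x.exponent = a :=
  ⟨⟨(k, fun j => ⟨a j, Nat.lt_succ_of_le (haB j)⟩), ha⟩, rfl, rfl⟩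

theorem exponent_le {B p : ℕ} (x : BoundedGenerator K B p) (j : Fin d) : x.exponent j ≤ B :=
  Nat.le_of_lt_succ (x.1.2 j).2

theorem label_surjective {β : ℕ} (hK : ∀ k, IsExponentFamily β (K k)) (p : ℕ) :
    Function.Surjective (label : BoundedGenerator K (β * p) p → κ) := by
  intro k
  obtain ⟨c, hc⟩ := (hK k).nonempty p
  obtain ⟨a, ha, -, haB⟩ := (hK k).exists_le p c hc
  obtain ⟨x, hx, -⟩ := exists_exponent_eq ha haB
  exact ⟨x, hx⟩

end BoundedGenerator

/-- The exponents of the product of the ideals with exponent sets `K k (n k)`. -/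
def productSet [Fintype κ] (K : κ → ℕ → Set (Fin d → ℕ)) (n : κ → ℕ) : Set (Fin d → ℕ) :=
  {c | ∃ a : κ → Fin d → ℕ, (∀ k, a k ∈ K k (n k)) ∧ ∑ k, a k ≤ c}

variable [Fintype κ] {K : κ → ℕ → Set (Fin d → ℕ)} {β : ℕ}

theorem productSet_isUpperSet (K : κ → ℕ → Set (Fin d → ℕ)) (n : κ → ℕ) :
    IsUpperSet (productSet K n) := by
  rintro c c' hc ⟨a, ha, h⟩
  exact ⟨a, ha, h.trans hc⟩

theorem productSet_add (hK : ∀ k, IsExponentFamily β (K k)) {n n' : κ → ℕ} {c c' : Fin d → ℕ}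
    (hc : c ∈ productSet K n) (hc' : c' ∈ productSet K n') : c + c' ∈ productSet K (n + n') := by
  obtain ⟨a, ha, h⟩ := hc
  obtain ⟨a', ha', h'⟩ := hc'
  refine ⟨a + a', fun k => (hK k).add _ _ _ (ha k) _ (ha' k), ?_⟩
  simp only [Pi.add_apply, Finset.sum_add_distrib]
  exact add_le_add h h'

theorem productSet_nonempty (hK : ∀ k, IsExponentFamily β (K k)) (n : κ → ℕ) :
    (productSet K n).Nonempty := by
  choose a ha using fun k => (hK k).nonempty (n k)
  exact ⟨_, a, ha, le_rfl⟩

variable [DecidableEq κ]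

theorem productSet_subset_update (hK : ∀ k, IsExponentFamily β (K k)) (n : κ → ℕ) (k₀ : κ) :
    productSet K n ⊆ productSet K (Function.update n k₀ 0) := by
  rintro c ⟨a, ha, h⟩
  refine ⟨a, fun k => ?_, h⟩
  by_cases hk : k = k₀
  · subst hk; simp [(hK k).zero]
  · rw [Function.update_of_ne hk]; exact ha k

theorem mem_productSet_of_le (hK : ∀ k, IsExponentFamily β (K k)) {k₀ : κ}
    (hx : ∀ n j, Pi.single j (β * n) ∈ K k₀ n) {n : κ → ℕ} {c : Fin d → ℕ}
    (hc : c ∈ productSet K (Function.update n k₀ 0)) {j : Fin d} (hj : β * ∑ k, n k ≤ c j) :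
    c ∈ productSet K n := by
  obtain ⟨a, ha, h⟩ := hc
  choose a' ha' hle hβ using fun k => (hK k).exists_le _ _ (ha k)
  refine ⟨Function.update a' k₀ (Pi.single j (β * n k₀)), fun k => ?_, fun l => ?_⟩
  · by_cases hk : k = k₀
    · subst hk; simpa using hx (n k) j
    · have := ha' k
      rw [Function.update_of_ne hk] at this ⊢
      exact this
  · rw [Finset.sum_apply]
    by_cases hl : l = j
    · subst hl
      refine le_trans ?_ hj
      rw [Finset.mul_sum]
      refine Finset.sum_le_sum fun k _ => ?_
      by_cases hk : k = k₀
      · subst hk; simp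
      · have := hβ k l
        rw [Function.update_of_ne hk] at this ⊢
        exact this
    · refine le_trans ?_ (h l)
      rw [Finset.sum_apply]
      refine Finset.sum_le_sum fun k _ => ?_
      by_cases hk : k = k₀
      · subst hk; simp [hl]
      · rw [Function.update_of_ne hk]; exact hle k l

theorem finite_productSet_diff (hK : ∀ k, IsExponentFamily β (K k)) {k₀ : κ}
    (hx : ∀ n j, Pi.single j (β * n) ∈ K k₀ n) (n : κ → ℕ) :
    (productSet K (Function.update n k₀ 0) \ productSet K n).Finite := by
  refine (finite_box (β * ∑ k, n k)).subset fun c hc j => ?_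
  by_contra! hle
  exact hc.2 (mem_productSet_of_le hK hx hc.1 hle)

theorem tendsto_ncard_diff (p : ℕ) (hp : 0 < p) (R : ℕ) {A A' : ℕ → Set (Fin d → ℕ)}
    (hup : ∀ q, IsUpperSet (A q)) (hne : ∀ q, (A q).Nonempty)
    (hadd : ∀ i j, ∀ a ∈ A i, ∀ b ∈ A j, a + b ∈ A (i + j))
    (hup' : ∀ q, IsUpperSet (A' q)) (hne' : ∀ q, (A' q).Nonempty)
    (hadd' : ∀ i j, ∀ a ∈ A' i, ∀ b ∈ A' j, a + b ∈ A' (i + j)) (hsub : ∀ q, A' q ⊆ A q)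
    (hbox : ∀ q, ∀ c ∈ A q \ A' q, ∀ j, c j < R * (p * q)) :
    Tendsto (fun q : ℕ => ((A q \ A' q).ncard : ℝ) / ((p * q : ℕ) : ℝ) ^ d) atTop
      (𝓝 (volume.real (limitBody p A ∩ {x | ∀ j, x j < R}) -
        volume.real (limitBody p A' ∩ {x | ∀ j, x j < R}))) := by
  refine ((tendsto_ncard_inter_box p hp R hup hne hadd).sub
    (tendsto_ncard_inter_box p hp R hup' hne' hadd')).congr fun q => ?_
  rw [← sub_div, ← ncard_diff_add_ncard_inter_box (hsub q) (hbox q), Nat.cast_add,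
    add_sub_cancel_right]

theorem sum_smul_mem_powerSet {ι : Type*} [Fintype ι] (g : ι → Fin d → ℕ) {b : ι → κ} {f : κ → ι}
    (hf : ∀ k, b (f k) = k) (n : κ → ℕ) : ∑ k, n k • g (f k) ∈ powerSet g b n := by
  classical
  refine ⟨∑ k, Pi.single (f k) (n k), ?_, ?_⟩
  · have : ∀ s : Finset κ, labelDegree b (∑ k ∈ s, Pi.single (f k) (n k)) =
        ∑ k ∈ s, Pi.single k (n k) := by
      intro s
      induction s using Finset.induction_on with
      | empty => ext; simp [labelDegree]
      | insert k s hk ih =>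
        rw [Finset.sum_insert hk, Finset.sum_insert hk, labelDegree_add, ih, labelDegree_single, hf]
    rw [this]
    exact Finset.univ_sum_single n
  · simp only [Finset.sum_apply, Finset.sum_smul]
    rw [Finset.sum_comm]
    exact Finset.sum_le_sum fun k _ => (sum_single_smul g (f k) (n k)).le

theorem powerSet_subset_productSet (hK : ∀ k, IsExponentFamily β (K k)) {ι : Type*} [Fintype ι]
    {g : ι → Fin d → ℕ} {b : ι → κ} {p : ℕ} (hg : ∀ i, g i ∈ K (b i) p) (n : κ → ℕ) :
    powerSet g b n ⊆ productSet K (p • n) := by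
  classical
  rintro c ⟨u, rfl, h⟩
  refine ⟨fun k => ∑ i, if b i = k then u i • g i else 0, fun k => ?_, ?_⟩
  · have : ∀ s : Finset ι, (∑ i ∈ s, if b i = k then u i • g i else 0) ∈
        K k (p * ∑ i ∈ s, if b i = k then u i else 0) := by
      intro s
      induction s using Finset.induction_on with
      | empty => simp [(hK k).zero]
      | insert i s hi ih =>
        rw [Finset.sum_insert hi, Finset.sum_insert hi, mul_add]
        refine (hK k).add _ _ _ ?_ _ ih
        split_ifs with hb
        · subst hb
          rw [mul_comm]
          exact (hK _).smul_mem (hg i) _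
        · simp [(hK k).zero]
    exact this Finset.univ
  · rw [Finset.sum_comm]
    simpa using h

namespace BoundedGenerator

instance (B p : ℕ) : Fintype (BoundedGenerator K B p) := Fintype.ofFinite _

end BoundedGenerator

variable (K) in
/-- The exponents of the products of powers of the `p`-th members of the families. -/
def veroneseSet (β p : ℕ) (n : κ → ℕ) : Set (Fin d → ℕ) :=
  powerSet (BoundedGenerator.exponent (K := K) (B := β * p) (p := p)) BoundedGenerator.label n

theorem veroneseSet_nonempty (hK : ∀ k, IsExponentFamily β (K k)) (p : ℕ) (n : κ → ℕ) :
    (veroneseSet K β p n).Nonempty :=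
  ⟨_, smul_mem_powerSet BoundedGenerator.exponent_le (BoundedGenerator.label_surjective hK p) n⟩

theorem exists_form_veroneseSet (hK : ∀ k, IsExponentFamily β (K k)) {k₀ : κ}
    (hx : ∀ n j, Pi.single j (β * n) ∈ K k₀ n) {p : ℕ} (hp : 0 < p) :
    ∃ G : MvPolynomial κ ℝ, IsNonnegForm d G ∧ ∀ n : κ → ℕ, eval (fun k => (n k : ℝ)) G =
      volume.real (limitBody p (fun q => veroneseSet K β p (q • Function.update n k₀ 0)) ∩
        {x | ∀ j, x j < (β * ∑ k, n k : ℕ)}) -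
      volume.real (limitBody p (fun q => veroneseSet K β p (q • n)) ∩
        {x | ∀ j, x j < (β * ∑ k, n k : ℕ)}) := by
  have hgen : ∀ j, ∃ i : BoundedGenerator K (β * p) p,
      i.label = k₀ ∧ i.exponent ≤ Pi.single j (β * p) := by
    intro j
    obtain ⟨i, hi, he⟩ := BoundedGenerator.exists_exponent_eq (B := β * p) (hx p j) fun l => by
      by_cases hl : l = j
      · subst hl; simp
      · simp [hl]
    exact ⟨i, hi, he.le⟩
  obtain ⟨G, hG, hlim⟩ := exists_form_powerSet BoundedGenerator.exponent_le
    (BoundedGenerator.label_surjective hK p) hgen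
  have hp' : (0 : ℝ) < p := by exact_mod_cast hp
  refine ⟨C ((p : ℝ) ^ d)⁻¹ * G, ⟨?_, fun e => ?_⟩, fun n => ?_⟩
  · simpa using (isHomogeneous_C κ ((p : ℝ) ^ d)⁻¹).mul hG.1
  · rw [coeff_C_mul]
    exact mul_nonneg (by positivity) (hG.2 e)
  · have h1 := tendsto_ncard_diff p hp (β * ∑ k, n k)
      (A := fun q => veroneseSet K β p (q • Function.update n k₀ 0))
      (A' := fun q => veroneseSet K β p (q • n))
      (fun q => powerSet_isUpperSet _ _ _) (fun q => veroneseSet_nonempty hK p _)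
      (fun i j a ha b hb => by rw [add_smul]; exact powerSet_add ha hb)
      (fun q => powerSet_isUpperSet _ _ _) (fun q => veroneseSet_nonempty hK p _)
      (fun i j a ha b hb => by rw [add_smul]; exact powerSet_add ha hb)
      (fun q => by
        simp only [← update_smul_zero]
        exact powerSet_subset_update _ _ _ _)
      (fun q c hc j => by
        simp only [← update_smul_zero] at hc
        by_contra! hle
        refine hc.2 (mem_powerSet_of_le BoundedGenerator.exponent_le hgen hc.1 (j := j) ?_)
        refine le_trans (le_of_eq ?_) hle
        simp only [Pi.smul_apply, smul_eq_mul, ← Finset.mul_sum]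
        ring)
    refine tendsto_nhds_unique ?_ h1
    rw [map_mul, eval_C]
    refine ((hlim n).const_mul _).congr fun q => ?_
    simp only [update_smul_zero]
    push_cast
    rw [mul_pow, veroneseSet, veroneseSet]
    field_simp

theorem limitBody_veroneseSet_subset (hK : ∀ k, IsExponentFamily β (K k)) {p : ℕ} (hp : 0 < p)
    (n : κ → ℕ) : limitBody p (fun q => veroneseSet K β p (q • n)) ⊆
      limitBody 1 (fun q => productSet K (q • n)) := by
  rintro x ⟨q, hq, a, ha, h⟩
  refine ⟨p * q, Nat.mul_pos hp hq, a, ?_, fun j => ?_⟩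
  · change a ∈ productSet K ((p * q) • n)
    rw [mul_smul]
    exact powerSet_subset_productSet hK (fun i => i.2) _ ha
  · simpa using h j

theorem eventually_mem_limitBody_veroneseSet (hK : ∀ k, IsExponentFamily β (K k)) (n : κ → ℕ)
    {x : Fin d → ℝ} (hx : x ∈ limitBody 1 (fun q => productSet K (q • n))) :
    ∀ᶠ N : ℕ in atTop, x ∈ limitBody N.factorial
      (fun q => veroneseSet K β N.factorial (q • n)) := by
  obtain ⟨m, hm, c, ⟨a, ha, hac⟩, hc⟩ := hx
  filter_upwards [eventually_ge_atTop (∑ k, m * n k)] with N hN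
  have hex : ∀ k, ∃ i : BoundedGenerator K (β * N.factorial) N.factorial,
      i.label = k ∧ (m * n k) • i.exponent ≤ N.factorial • a k := by
    intro k
    rcases Nat.eq_zero_or_pos (m * n k) with h0 | h0
    · obtain ⟨i, hi⟩ := BoundedGenerator.label_surjective hK N.factorial k
      refine ⟨i, hi, ?_⟩
      rw [h0, zero_smul]
      exact fun _ => Nat.zero_le _
    · obtain ⟨t, ht⟩ := Nat.dvd_factorial h0
        ((Finset.single_le_sum (f := fun k => m * n k) (fun _ _ => Nat.zero_le _)
          (Finset.mem_univ k)).trans hN)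
      have h1 : t • a k ∈ K k N.factorial := by
        rw [ht, mul_comm]
        exact (hK k).smul_mem (ha k) t
      obtain ⟨a', ha', hle, hβ⟩ := (hK k).exists_le _ _ h1
      obtain ⟨i, hi, he⟩ := BoundedGenerator.exists_exponent_eq ha' hβ
      refine ⟨i, hi, ?_⟩
      rw [he, ht, mul_smul (m * n k)]
      exact nsmul_le_nsmul_right hle _
  choose f hf hfa using hex
  refine ⟨m, hm, _, sum_smul_mem_powerSet _ hf (m • n), fun j => ?_⟩
  have h1 : (∑ k, (m • n) k • (f k).exponent) ≤ N.factorial • c := by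
    refine (Finset.sum_le_sum fun k _ => hfa k).trans ?_
    rw [← Finset.smul_sum]
    exact nsmul_le_nsmul_right hac _
  have h2 : ((∑ k, (m • n) k • (f k).exponent) j : ℝ) ≤ N.factorial * c j := by
    exact_mod_cast h1 j
  have h3 : (c j : ℝ) ≤ m * x j := by simpa using hc j
  refine h2.trans ?_
  rw [mul_assoc]
  exact mul_le_mul_of_nonneg_left h3 (by positivity)

theorem tendsto_volume_limitBody_veroneseSet (hK : ∀ k, IsExponentFamily β (K k)) (n : κ → ℕ)
    (R : ℕ) : Tendsto (fun N : ℕ => volume.real (limitBody N.factorial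
        (fun q => veroneseSet K β N.factorial (q • n)) ∩ {x | ∀ j, x j < R})) atTop
      (𝓝 (volume.real (limitBody 1 (fun q => productSet K (q • n)) ∩ {x | ∀ j, x j < R}))) := by
  refine (ENNReal.tendsto_toReal (volume_limitBody_inter_box_ne_top one_pos _ R)).comp
    (tendsto_measure_of_ae_tendsto_indicator atTop (measurableSet_limitBody_inter_box _ _ R)
      (fun N => measurableSet_limitBody_inter_box _ _ R)
      (measurableSet_limitBody_inter_box _ _ R)
      (volume_limitBody_inter_box_ne_top one_pos (fun q => productSet K (q • n)) R)
      (Eventually.of_forall fun N => Set.inter_subset_inter_left _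
        (limitBody_veroneseSet_subset hK N.factorial_pos n)) (ae_of_all _ fun x => ?_))
  by_cases hx : x ∈ limitBody 1 (fun q => productSet K (q • n))
  · filter_upwards [eventually_mem_limitBody_veroneseSet hK n hx] with N hN
    exact and_congr_left fun _ => iff_of_true hN hx
  · refine Eventually.of_forall fun N => ?_
    have : x ∉ limitBody N.factorial (fun q => veroneseSet K β N.factorial (q • n)) :=
      fun h => hx (limitBody_veroneseSet_subset hK N.factorial_pos n h)
    exact and_congr_left fun _ => iff_of_false this hx

theorem tendsto_ncard_productSet_diff (hK : ∀ k, IsExponentFamily β (K k)) {k₀ : κ}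
    (hx : ∀ n j, Pi.single j (β * n) ∈ K k₀ n) (n : κ → ℕ) :
    Tendsto (fun m : ℕ => ((productSet K (m • Function.update n k₀ 0) \
        productSet K (m • n)).ncard : ℝ) / (m : ℝ) ^ d) atTop
      (𝓝 (volume.real (limitBody 1 (fun q => productSet K (q • Function.update n k₀ 0)) ∩
          {x | ∀ j, x j < (β * ∑ k, n k : ℕ)}) -
        volume.real (limitBody 1 (fun q => productSet K (q • n)) ∩
          {x | ∀ j, x j < (β * ∑ k, n k : ℕ)}))) := by
  have h1 := tendsto_ncard_diff 1 one_pos (β * ∑ k, n k)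
    (A := fun q => productSet K (q • Function.update n k₀ 0))
    (A' := fun q => productSet K (q • n))
    (fun q => productSet_isUpperSet _ _) (fun q => productSet_nonempty hK _)
    (fun i j a ha b hb => by rw [add_smul]; exact productSet_add hK ha hb)
    (fun q => productSet_isUpperSet _ _) (fun q => productSet_nonempty hK _)
    (fun i j a ha b hb => by rw [add_smul]; exact productSet_add hK ha hb)
    (fun q => by
      simp only [← update_smul_zero]
      exact productSet_subset_update hK _ _)
    (fun q c hc j => by
      simp only [← update_smul_zero] at hc
      by_contra! hle
      refine hc.2 (mem_productSet_of_le hK hx hc.1 (j := j) ?_)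
      refine le_trans (le_of_eq ?_) hle
      simp only [Pi.smul_apply, smul_eq_mul, ← Finset.mul_sum]
      ring)
  simpa using h1

end ExponentFamily

section LimitOfForms

open Topology

variable {κ : Type*} [Fintype κ]

theorem IsNonnegForm.mem_finsuppAntidiag [DecidableEq κ] {d : ℕ} {G : MvPolynomial κ ℝ}
    (hG : IsNonnegForm d G) {e : κ →₀ ℕ} (he : G.coeff e ≠ 0) :
    e ∈ Finset.univ.finsuppAntidiag d := by
  rw [Finset.mem_finsuppAntidiag]
  refine ⟨?_, Finset.subset_univ _⟩
  rw [← Finsupp.degree_eq_sum, Finsupp.degree_eq_weight_one]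
  exact hG.1 he

theorem IsNonnegForm.eval_eq_sum [DecidableEq κ] {d : ℕ} {G : MvPolynomial κ ℝ}
    (hG : IsNonnegForm d G) (x : κ → ℝ) :
    eval x G = ∑ e ∈ Finset.univ.finsuppAntidiag d, G.coeff e * ∏ k, x k ^ e k := by
  rw [eval_eq']
  refine Finset.sum_subset (fun e he => hG.mem_finsuppAntidiag (mem_support_iff.1 he))
    fun e _ he => ?_
  rw [notMem_support_iff.1 he, zero_mul]

theorem exists_form_of_tendsto {d : ℕ} {G : ℕ → MvPolynomial κ ℝ} (hG : ∀ N, IsNonnegForm d (G N))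
    {F : (κ → ℕ) → ℝ}
    (hF : ∀ n, Tendsto (fun N => eval (fun k => (n k : ℝ)) (G N)) atTop (𝓝 (F n))) :
    ∃ P : MvPolynomial κ ℝ, IsNonnegForm d P ∧ ∀ n : κ → ℕ, eval (fun k => (n k : ℝ)) P = F n := by
  classical
  set E : Finset (κ →₀ ℕ) := Finset.univ.finsuppAntidiag d with hE
  obtain ⟨C, hC⟩ := (hF 1).bddAbove_range
  have hcoeff : ∀ N, (fun e : E => (G N).coeff e) ∈ Set.Icc (0 : E → ℝ) fun _ => C := by
    intro N
    refine ⟨fun e => (hG N).2 e, fun e => ?_⟩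
    refine le_trans ?_ (hC ⟨N, rfl⟩)
    dsimp only
    rw [(hG N).eval_eq_sum]
    refine le_trans (le_of_eq ?_) (Finset.single_le_sum
      (f := fun e : κ →₀ ℕ => (G N).coeff e * ∏ k, (((1 : κ → ℕ) k : ℕ) : ℝ) ^ e k)
      (fun e _ => mul_nonneg ((hG N).2 e) (Finset.prod_nonneg fun _ _ => by positivity)) e.2)
    simp
  obtain ⟨v, hv, φ, hφ, hlim⟩ := isCompact_Icc.tendsto_subseq hcoeff
  rw [tendsto_pi_nhds] at hlim
  set P : MvPolynomial κ ℝ := ∑ e : E, monomial (e : κ →₀ ℕ) (v e) with hP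
  refine ⟨P, ⟨?_, fun e => ?_⟩, fun n => ?_⟩
  · refine IsHomogeneous.sum _ _ _ fun e _ => isHomogeneous_monomial _ ?_
    rw [Finsupp.degree_eq_sum]
    exact (Finset.mem_finsuppAntidiag.1 e.2).1
  · rw [hP, coeff_sum]
    refine Finset.sum_nonneg fun e' _ => ?_
    rw [coeff_monomial]
    split_ifs
    · exact hv.1 e'
    · exact le_rfl
  · have h1 := (hF n).comp hφ.tendsto_atTop
    refine tendsto_nhds_unique ?_ h1
    have h2 : Tendsto (fun N => ∑ e : E, (G (φ N)).coeff e * ∏ k, (n k : ℝ) ^ (e : κ →₀ ℕ) k) atTop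
        (𝓝 (∑ e : E, v e * ∏ k, (n k : ℝ) ^ (e : κ →₀ ℕ) k)) :=
      tendsto_finsetSum _ fun e _ => (hlim e).mul_const _
    convert h2 using 1
    · ext N
      simp only [Function.comp]
      rw [(hG _).eval_eq_sum]
      exact (Finset.sum_coe_sort E fun e => (G (φ N)).coeff e * ∏ k, (n k : ℝ) ^ e k).symm
    · rw [hP, map_sum]
      congr 1
      refine Finset.sum_congr rfl fun e _ => ?_
      rw [eval_monomial, Finsupp.prod_fintype _ _ (by simp)]

variable [DecidableEq κ] {d β : ℕ} {K : κ → ℕ → Set (Fin d → ℕ)}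

theorem exists_form_productSet (hK : ∀ k, IsExponentFamily β (K k)) {k₀ : κ}
    (hx : ∀ n j, Pi.single j (β * n) ∈ K k₀ n) :
    ∃ G : MvPolynomial κ ℝ, IsNonnegForm d G ∧ (∀ e, G.coeff e ≠ 0 → 0 < e k₀) ∧ ∀ n : κ → ℕ,
      Tendsto (fun m : ℕ => ((productSet K (m • Function.update n k₀ 0) \
        productSet K (m • n)).ncard : ℝ) / (m : ℝ) ^ d) atTop
        (𝓝 (eval (fun k => (n k : ℝ)) G)) := by
  choose G hG hGv using fun N : ℕ => exists_form_veroneseSet hK hx N.factorial_pos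
  obtain ⟨P, hP, hPv⟩ := exists_form_of_tendsto hG (F := _) fun n => by
    simp only [hGv]
    exact (tendsto_volume_limitBody_veroneseSet hK (Function.update n k₀ 0) (β * ∑ k, n k)).sub
      (tendsto_volume_limitBody_veroneseSet hK n (β * ∑ k, n k))
  have hlim := fun n : κ → ℕ => tendsto_ncard_productSet_diff hK hx n
  simp only [← hPv] at hlim
  refine ⟨P, hP, fun e he => ?_, hlim⟩
  by_contra! h0
  have h0 : e k₀ = 0 := Nat.le_zero.1 h0
  have h1 := hlim (Function.update 1 k₀ 0)
  simp only [Function.update_idem, sdiff_self, Set.bot_eq_empty, Set.ncard_empty, Nat.cast_zero,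
    zero_div] at h1
  have h2 := tendsto_nhds_unique h1 tendsto_const_nhds
  rw [hP.eval_eq_sum, Finset.sum_eq_zero_iff_of_nonneg fun e _ =>
    mul_nonneg (hP.2 e) (Finset.prod_nonneg fun _ _ => by positivity)] at h2
  have h3 := h2 e (hP.mem_finsuppAntidiag he)
  refine he ((mul_eq_zero.1 h3).resolve_right (Finset.prod_ne_zero_iff.2 fun k _ => ?_))
  by_cases hk : k = k₀
  · subst hk; simp [h0]
  · simp [hk]

end LimitOfForms

section MonomialIdeal

variable {𝕜 : Type*} [Field 𝕜] {d : ℕ}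

/-- The exponents of the monomials which belong to an ideal. -/
def exponentSet (A : Ideal (MvPolynomial (Fin d) 𝕜)) : Set (Fin d → ℕ) :=
  {a | monomial (Finsupp.equivFunOnFinite.symm a) (1 : 𝕜) ∈ A}

theorem mem_exponentSet_coe {A : Ideal (MvPolynomial (Fin d) 𝕜)} {m : Fin d →₀ ℕ} :
    (m : Fin d → ℕ) ∈ exponentSet A ↔ monomial m (1 : 𝕜) ∈ A := by
  rw [exponentSet, Set.mem_ofPred_eq, Finsupp.equivFunOnFinite_symm_coe]

theorem monomial_add_mem {A B : Ideal (MvPolynomial (Fin d) 𝕜)} {m m' : Fin d →₀ ℕ}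
    (hm : monomial m (1 : 𝕜) ∈ A) (hm' : monomial m' (1 : 𝕜) ∈ B) :
    monomial (m + m') (1 : 𝕜) ∈ A * B := by
  have := Ideal.mul_mem_mul hm hm'
  rwa [monomial_mul, one_mul] at this

theorem equivFunOnFinite_symm_add (a b : Fin d → ℕ) :
    Finsupp.equivFunOnFinite.symm (a + b) =
      Finsupp.equivFunOnFinite.symm a + Finsupp.equivFunOnFinite.symm b := by
  ext j
  simp

theorem exponentSet_isUpperSet (A : Ideal (MvPolynomial (Fin d) 𝕜)) :
    IsUpperSet (exponentSet A) := by
  intro a b hab ha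
  obtain ⟨c, rfl⟩ := exists_add_of_le hab
  have h : monomial (Finsupp.equivFunOnFinite.symm a + Finsupp.equivFunOnFinite.symm c)
      (1 : 𝕜) ∈ A * ⊤ := monomial_add_mem ha Submodule.mem_top
  rw [← equivFunOnFinite_symm_add] at h
  exact Ideal.mul_le_left h

theorem exponentSet_top : exponentSet (⊤ : Ideal (MvPolynomial (Fin d) 𝕜)) = Set.univ :=
  Set.eq_univ_of_forall fun a =>
    show monomial (Finsupp.equivFunOnFinite.symm a) (1 : 𝕜) ∈ (⊤ : Ideal _) from
      Submodule.mem_top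

theorem add_mem_exponentSet_mul {A B : Ideal (MvPolynomial (Fin d) 𝕜)} {a b : Fin d → ℕ}
    (ha : a ∈ exponentSet A) (hb : b ∈ exponentSet B) : a + b ∈ exponentSet (A * B) := by
  change monomial (Finsupp.equivFunOnFinite.symm (a + b)) (1 : 𝕜) ∈ A * B
  rw [equivFunOnFinite_symm_add]
  exact monomial_add_mem ha hb

theorem IsMonomialIdeal.mem_iff {A : Ideal (MvPolynomial (Fin d) 𝕜)} (hA : IsMonomialIdeal A)
    {f : MvPolynomial (Fin d) 𝕜} :
    f ∈ A ↔ ∀ m ∈ f.support, (m : Fin d → ℕ) ∈ exponentSet A := by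
  classical
  obtain ⟨S, rfl⟩ := hA
  simp only [mem_exponentSet_coe, mem_ideal_span_monomial_image]
  simp [support_monomial]

theorem isMonomialIdeal_top : IsMonomialIdeal (⊤ : Ideal (MvPolynomial (Fin d) 𝕜)) := by
  refine ⟨{0}, ?_⟩
  rw [Set.image_singleton, Ideal.span_singleton_eq_top.2]
  exact isUnit_one

theorem image_monomial_mul_image_monomial (S T : Set (Fin d →₀ ℕ)) :
    (fun m => monomial m (1 : 𝕜)) '' S * (fun m => monomial m (1 : 𝕜)) '' T =
      (fun m => monomial m (1 : 𝕜)) '' (S + T) := by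
  ext f
  simp only [Set.mem_mul, Set.mem_image, Set.mem_add]
  constructor
  · rintro ⟨_, ⟨s, hs, rfl⟩, _, ⟨t, ht, rfl⟩, rfl⟩
    exact ⟨s + t, ⟨s, hs, t, ht, rfl⟩, by rw [monomial_mul, one_mul]⟩
  · rintro ⟨_, ⟨s, hs, t, ht, rfl⟩, rfl⟩
    exact ⟨_, ⟨s, hs, rfl⟩, _, ⟨t, ht, rfl⟩, by rw [monomial_mul, one_mul]⟩

theorem IsMonomialIdeal.mul {A B : Ideal (MvPolynomial (Fin d) 𝕜)} (hA : IsMonomialIdeal A)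
    (hB : IsMonomialIdeal B) : IsMonomialIdeal (A * B) := by
  obtain ⟨S, rfl⟩ := hA
  obtain ⟨T, rfl⟩ := hB
  exact ⟨S + T, by rw [Ideal.span_mul_span', image_monomial_mul_image_monomial]⟩

theorem exists_add_le_of_mem_exponentSet_mul {A B : Ideal (MvPolynomial (Fin d) 𝕜)}
    (hA : IsMonomialIdeal A) (hB : IsMonomialIdeal B) {c : Fin d → ℕ}
    (hc : c ∈ exponentSet (A * B)) : ∃ a ∈ exponentSet A, ∃ b ∈ exponentSet B, a + b ≤ c := by
  classical
  obtain ⟨S, rfl⟩ := hA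
  obtain ⟨T, rfl⟩ := hB
  rw [exponentSet, Set.mem_ofPred_eq, Ideal.span_mul_span',
    image_monomial_mul_image_monomial, mem_ideal_span_monomial_image] at hc
  obtain ⟨_, ⟨s, hs, t, ht, rfl⟩, hle⟩ := hc (Finsupp.equivFunOnFinite.symm c)
    (by simp [support_monomial])
  exact ⟨s, mem_exponentSet_coe.2 (Ideal.subset_span ⟨s, hs, rfl⟩), t,
    mem_exponentSet_coe.2 (Ideal.subset_span ⟨t, ht, rfl⟩), fun j => by simpa using hle j⟩

theorem isMonomialIdeal_prod {κ : Type*} {L : κ → Ideal (MvPolynomial (Fin d) 𝕜)}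
    (hL : ∀ k, IsMonomialIdeal (L k)) (s : Finset κ) : IsMonomialIdeal (∏ k ∈ s, L k) := by
  classical
  induction s using Finset.induction_on with
  | empty => rw [Finset.prod_empty, Ideal.one_eq_top]; exact isMonomialIdeal_top
  | insert k s hk ih => rw [Finset.prod_insert hk]; exact (hL k).mul ih

theorem mem_exponentSet_prod {κ : Type*} {L : κ → Ideal (MvPolynomial (Fin d) 𝕜)}
    (hL : ∀ k, IsMonomialIdeal (L k)) (s : Finset κ) {c : Fin d → ℕ} :
    c ∈ exponentSet (∏ k ∈ s, L k) ↔
      ∃ a : κ → Fin d → ℕ, (∀ k ∈ s, a k ∈ exponentSet (L k)) ∧ ∑ k ∈ s, a k ≤ c := by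
  classical
  induction s using Finset.induction_on generalizing c with
  | empty =>
    rw [Finset.prod_empty, Ideal.one_eq_top, exponentSet_top]
    exact iff_of_true trivial ⟨0, by simp, fun _ => by simp⟩
  | insert k s hk ih =>
    simp only [Finset.prod_insert hk, Finset.sum_insert hk]
    constructor
    · intro h
      obtain ⟨a, ha, b, hb, hab⟩ :=
        exists_add_le_of_mem_exponentSet_mul (hL k) (isMonomialIdeal_prod hL s) h
      obtain ⟨a', ha', hle⟩ := ih.1 hb
      have hsum : ∑ l ∈ s, Function.update a' k a l = ∑ l ∈ s, a' l :=
        Finset.sum_congr rfl fun l hl => by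
          rw [Function.update_of_ne]
          rintro rfl
          exact hk hl
      refine ⟨Function.update a' k a, fun l hl => ?_, ?_⟩
      · by_cases hlk : l = k
        · subst hlk; simpa using ha
        · rw [Function.update_of_ne hlk]
          exact ha' l ((Finset.mem_insert.1 hl).resolve_left hlk)
      · rw [hsum, Function.update_self]
        exact (add_le_add le_rfl hle).trans hab
    · rintro ⟨a, ha, hle⟩
      exact exponentSet_isUpperSet _ hle (add_mem_exponentSet_mul
        (ha k (Finset.mem_insert_self k s))
        (ih.2 ⟨a, fun l hl => ha l (Finset.mem_insert_of_mem hl), le_rfl⟩))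

theorem quotDim_eq_ncard {A B : Ideal (MvPolynomial (Fin d) 𝕜)} (hA : IsMonomialIdeal A)
    (hB : IsMonomialIdeal B) (hfin : (exponentSet A \ exponentSet B).Finite) :
    quotDim 𝕜 A B = (exponentSet A \ exponentSet B).ncard := by
  classical
  have := hfin.fintype
  let T := ↥(exponentSet A \ exponentSet B)
  let toF : (Fin d → ℕ) → (Fin d →₀ ℕ) := Finsupp.equivFunOnFinite.symm
  have htoF : Function.Injective toF := Finsupp.equivFunOnFinite.symm.injective
  let φ : ↥(Submodule.restrictScalars 𝕜 A) →ₗ[𝕜] (T → 𝕜) :=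
    (LinearMap.pi fun t : T => lcoeff 𝕜 (toF t.1)) ∘ₗ (Submodule.restrictScalars 𝕜 A).subtype
  have hφ : ∀ f t, φ f t = coeff (toF t.1) (f : MvPolynomial (Fin d) 𝕜) := fun f t => rfl
  have hsurj : Function.Surjective φ := by
    intro v
    have hmem : ∑ t : T, C (v t) * monomial (toF t.1) (1 : 𝕜) ∈ A :=
      sum_mem fun t _ => Ideal.mul_mem_left _ _ t.2.1
    refine ⟨⟨_, hmem⟩, ?_⟩
    ext t
    rw [hφ]
    simp only [coeff_sum, coeff_C_mul, coeff_monomial]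
    rw [Finset.sum_eq_single t]
    · simp
    · intro t' _ ht'
      rw [if_neg, mul_zero]
      exact fun h => ht' (Subtype.ext (htoF h))
    · simp
  have hker : LinearMap.ker φ = Submodule.comap (Submodule.restrictScalars 𝕜 A).subtype
      (Submodule.restrictScalars 𝕜 B) := by
    ext f
    rw [LinearMap.mem_ker, Submodule.mem_comap, Submodule.restrictScalars_mem,
      Submodule.subtype_apply, hB.mem_iff, _root_.funext_iff]
    constructor
    · intro h m hm
      by_contra hmB
      have hmA := hA.mem_iff.1 f.2 m hm
      have h1 := h ⟨m, hmA, hmB⟩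
      rw [hφ] at h1
      simp only [toF, Finsupp.equivFunOnFinite_symm_coe] at h1
      exact mem_support_iff.1 hm h1
    · intro h t
      rw [hφ]
      by_contra h1
      have h2 := h _ (mem_support_iff.2 h1)
      exact t.2.2 h2
  rw [quotDim, ← hker, (φ.quotKerEquivOfSurjective hsurj).finrank_eq,
    Module.finrank_fintype_fun_eq_card, Set.ncard_eq_toFinset_card', Set.toFinset_card]

theorem IsMonomialBounded.isMonomialIdeal {A : Ideal (MvPolynomial (Fin d) 𝕜)} {b : ℕ}
    (hA : IsMonomialBounded A b) : IsMonomialIdeal A := by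
  obtain ⟨-, S, -, h⟩ := hA
  exact ⟨S, h⟩

theorem IsMonomialBounded.exponentSet_nonempty {A : Ideal (MvPolynomial (Fin d) 𝕜)} {b : ℕ}
    (hA : IsMonomialBounded A b) : (exponentSet A).Nonempty := by
  obtain ⟨hne, S, -, rfl⟩ := hA
  obtain ⟨s, hs⟩ : S.Nonempty := by
    rw [Set.nonempty_iff_ne_empty]
    rintro rfl
    simp at hne
  exact ⟨s, mem_exponentSet_coe.2 (Ideal.subset_span ⟨s, hs, rfl⟩)⟩

theorem IsMonomialBounded.exists_le {A : Ideal (MvPolynomial (Fin d) 𝕜)} {b : ℕ}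
    (hA : IsMonomialBounded A b) {c : Fin d → ℕ} (hc : c ∈ exponentSet A) :
    ∃ a ∈ exponentSet A, a ≤ c ∧ ∀ j, a j ≤ b := by
  classical
  obtain ⟨-, S, hS, rfl⟩ := hA
  rw [exponentSet, Set.mem_ofPred_eq, mem_ideal_span_monomial_image] at hc
  obtain ⟨s, hs, hle⟩ := hc (Finsupp.equivFunOnFinite.symm c) (by simp [support_monomial])
  exact ⟨s, mem_exponentSet_coe.2 (Ideal.subset_span ⟨s, hs, rfl⟩), fun j => by simpa using hle j,
    fun j => (Finset.single_le_sum (f := s) (fun _ _ => Nat.zero_le _) (Finset.mem_univ j)).trans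
      (hS s hs)⟩

theorem isExponentFamily_of_isMonomialBounded {J : ℕ → Ideal (MvPolynomial (Fin d) 𝕜)} {β β' : ℕ}
    (hJ : IsGradedFamily J) (hJb : ∀ n, IsMonomialBounded (J n) (β * n)) (hβ : β ≤ β') :
    IsExponentFamily β' fun n => exponentSet (J n) where
  isUpperSet n := exponentSet_isUpperSet _
  zero := by rw [hJ.1, exponentSet_top]
  add i j a ha b hb := hJ.2 i j (add_mem_exponentSet_mul ha hb)
  nonempty n := (hJb n).exponentSet_nonempty
  exists_le n c hc := by
    obtain ⟨a, ha, hle, h⟩ := (hJb n).exists_le hc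
    exact ⟨a, ha, hle, fun j => (h j).trans (Nat.mul_le_mul_right n hβ)⟩

theorem single_mem_exponentSet {I : ℕ → Ideal (MvPolynomial (Fin d) 𝕜)} (hI : IsGradedFamily I)
    {β : ℕ} (hβ : mId 𝕜 d ^ β ≤ I 1) (n : ℕ) (j : Fin d) :
    Pi.single j (β * n) ∈ exponentSet (I n) := by
  induction n with
  | zero => simp [hI.1, exponentSet_top]
  | succ n ih =>
    have h1 : Pi.single j β ∈ exponentSet (I 1) := by
      have hX : (X j : MvPolynomial (Fin d) 𝕜) ^ β ∈ I 1 :=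
        hβ (Ideal.pow_mem_pow (show X j ∈ mId 𝕜 d from
          Ideal.subset_span (Set.mem_range_self j)) β)
      rw [X_pow_eq_monomial] at hX
      have := mem_exponentSet_coe.2 hX
      rwa [Finsupp.single_eq_pi_single] at this
    have := hI.2 n 1 (add_mem_exponentSet_mul ih h1)
    rwa [mul_add, mul_one, Pi.single_add]

theorem isExponentFamily_of_pow_le {I : ℕ → Ideal (MvPolynomial (Fin d) 𝕜)}
    (hI : IsGradedFamily I) {β : ℕ} (hβ : mId 𝕜 d ^ β ≤ I 1) (hd : 0 < d) :
    IsExponentFamily β fun n => exponentSet (I n) where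
  isUpperSet n := exponentSet_isUpperSet _
  zero := by rw [hI.1, exponentSet_top]
  add i j a ha b hb := hI.2 i j (add_mem_exponentSet_mul ha hb)
  nonempty n := ⟨_, single_mem_exponentSet hI hβ n ⟨0, hd⟩⟩
  exists_le n c hc := by
    by_cases h : ∃ j, β * n ≤ c j
    · obtain ⟨j, hj⟩ := h
      refine ⟨_, single_mem_exponentSet hI hβ n j, fun l => ?_, fun l => ?_⟩ <;>
      by_cases hl : l = j
      · subst hl; simpa using hj
      · simp [hl]
      · subst hl; simp
      · simp [hl]
    · push Not at h
      exact ⟨c, hc, le_rfl, fun j => (h j).le⟩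

theorem exponentSet_prod_eq_productSet {κ : Type*} [Fintype κ]
    {L : κ → ℕ → Ideal (MvPolynomial (Fin d) 𝕜)} (hL : ∀ k n, IsMonomialIdeal (L k n))
    (n : κ → ℕ) : exponentSet (∏ k, L k (n k)) =
      productSet (fun k n => exponentSet (L k n)) n := by
  ext c
  rw [mem_exponentSet_prod fun k => hL k (n k)]
  simp [productSet]

end MonomialIdeal

/-- **Theorem A (existence of mixed multiplicities of graded families of monomial ideals).**
For a graded family `𝕀` of `𝔪`-primary monomial ideals and graded families
`𝕁(1), …, 𝕁(r)` of monomial ideals whose generator degrees grow at most linearly,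
the limit `F(n₀,𝐧) = lim_m dim_𝕜(𝐉_{m𝐧} / I_{m n₀} 𝐉_{m𝐧}) / m^d` exists and agrees with a
homogeneous polynomial `G` of total degree `d` with non-negative real coefficients, and every
monomial of `G` with nonzero coefficient has positive exponent in the variable `n₀`. -/
theorem statement0 {𝕜 : Type*} [Field 𝕜] (d r : ℕ) (hd : 0 < d)
    (I : ℕ → Ideal (MvPolynomial (Fin d) 𝕜))
    (J : Fin r → ℕ → Ideal (MvPolynomial (Fin d) 𝕜)) (β : ℕ)
    (hI : IsGradedFamily I)
    (hImon : ∀ n, IsMonomialIdeal (I n))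
    (hIprim : ∀ n, 0 < n → IsMPrimary (I n))
    (hJ : ∀ i, IsGradedFamily (J i))
    (hJb : ∀ i n, IsMonomialBounded (J i n) (β * n)) :
    ∃ G : MvPolynomial (Fin (r + 1)) ℝ,
      G.IsHomogeneous d ∧
      (∀ e : Fin (r + 1) →₀ ℕ, 0 ≤ G.coeff e) ∧
      (∀ e : Fin (r + 1) →₀ ℕ, G.coeff e ≠ 0 → 0 < e 0) ∧
      ∀ (n0 : ℕ) (n : Fin r → ℕ),
        Tendsto
          (fun m : ℕ =>
            (quotDim 𝕜 (∏ i, J i (m * n i)) (I (m * n0) * ∏ i, J i (m * n i)) : ℝ) /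
              (m : ℝ) ^ d)
          atTop
          (nhds (MvPolynomial.eval (Fin.cons (n0 : ℝ) fun i => (n i : ℝ)) G)) := by
  obtain ⟨b, hb⟩ := (hIprim 1 one_pos).2
  set β' := max β b with hβ'
  have hpow : mId 𝕜 d ^ β' ≤ I 1 := (Ideal.pow_le_pow_right (le_max_right β b)).trans hb
  let L : Fin (r + 1) → ℕ → Ideal (MvPolynomial (Fin d) 𝕜) := Fin.cons I J
  have hL : ∀ k n, IsMonomialIdeal (L k n) := by
    intro k n
    cases k using Fin.cases with
    | zero => exact hImon n
    | succ i => exact (hJb i n).isMonomialIdeal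
  have hK : ∀ k, IsExponentFamily β' fun n => exponentSet (L k n) := by
    intro k
    cases k using Fin.cases with
    | zero => exact isExponentFamily_of_pow_le hI hpow hd
    | succ i => exact isExponentFamily_of_isMonomialBounded (hJ i) (hJb i) (le_max_left β b)
  have hx : ∀ n j, Pi.single j (β' * n) ∈ exponentSet (L 0 n) :=
    single_mem_exponentSet hI hpow
  obtain ⟨G, hG, hG0, hlim⟩ := exists_form_productSet hK hx
  refine ⟨G, hG.1, hG.2, hG0, fun n0 n => ?_⟩
  have hcast : (fun k => (((Fin.cons n0 n : Fin (r + 1) → ℕ) k : ℕ) : ℝ)) =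
      Fin.cons (n0 : ℝ) fun i => (n i : ℝ) := by
    ext k
    cases k using Fin.cases <;> simp
  have h := hlim (Fin.cons n0 n)
  rw [hcast] at h
  refine h.congr fun m => ?_
  have hprod : ∏ i, J i (m * n i) =
      ∏ k, L k ((m • Function.update (Fin.cons n0 n : Fin (r + 1) → ℕ) 0 0) k) := by
    rw [Fin.prod_univ_succ]
    simp [L, hI.1, ← Ideal.one_eq_top]
  have hprod' : I (m * n0) * ∏ i, J i (m * n i) =
      ∏ k, L k ((m • (Fin.cons n0 n : Fin (r + 1) → ℕ)) k) := by
    rw [Fin.prod_univ_succ]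
    simp [L]
  rw [hprod', hprod, quotDim_eq_ncard (isMonomialIdeal_prod (fun k => hL k _) _)
    (isMonomialIdeal_prod (fun k => hL k _) _), exponentSet_prod_eq_productSet hL,
    exponentSet_prod_eq_productSet hL]
  rw [exponentSet_prod_eq_productSet hL, exponentSet_prod_eq_productSet hL, ← update_smul_zero]
  exact finite_productSet_diff hK hx _
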